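/- Let n = 4. A glueing datum of dimension n consists of: a finite nonempty index set I (indexing copies Δ_i of the standard n-simplex, realized as {x : {0,…,n} → [0,∞) | Σ_v x_v = 1}, with vertices labeled 0,…,n); a fixed-point-free involution P of the set I × {0,…,n} of codimension-1 faces, where (i,k) denotes the face {x ∈ Δ_i | x_k = 0}; and, for each face (i,k) with P(i,k) = (j,l), a bijection φ_{(i,k)} : {0,…,n}∖{k} → {0,…,n}∖{l}, subject to φ_{(j,l)} = φ_{(i,k)}⁻¹. Let X be the quotient of the disjoint union of the Δ_i by the identifications which, for each (i,k) with P(i,k) = (j,l), identify each point x of the face (i,k) with the point y of the face (j,l) given by y_{φ_{(i,k)}(a)} = x_a for a ≠ k and y_l = 0, with the quotient topology. Then the following are equivalent: (a) condition Cycl holds — for every cycle around a triangle, i.e., every data of m ≥ 1, indices i_0,…,i_m ∈ I, injections t_0,…,t_m : {0,1,2} → {0,…,4}, and choices k_r ∉ image(t_r) for 0 ≤ r < m with P(i_r,k_r) = (i_{r+1}, l_{r+1}), t_{r+1} = φ_{(i_r,k_r)} ∘ t_r, k_r ≠ l_r for all 0 < r < m, i_m = i_0, image(t_m) = image(t_0)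 and l_m ≠ k_0, one has t_m = t_0; (b) for every i ∈ I and every 3-element subset {a,b,c} of {0,…,4}, the image in X of the barycentre of the corresponding triangle of Δ_i (the point x with x_a = x_b = x_c = 1/3 and all other coordinates 0) has an open neighborhood in X homeomorphic to ℝ⁴. -/

import Mathlib

open scoped Classical

noncomputable section

/-- A glueing datum of dimension `n`: a finite nonempty set `I` indexing copies of the
standard `n`-simplex, a fixed-point-free involution `P` of the set `I × Fin (n+1)` of
codimension-1 faces (the face `(i,k)` of the `i`-th simplex being opposite to the vertex
`k`), and for each face `(i,k)` with `P (i,k) = (j,l)` a simplicial identification,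
encoded as a permutation `glue (i,k)` of the vertex labels sending `k` to `l` (its
restriction to `{0,…,n} \ {k}` is the bijection `φ_{(i,k)}` onto `{0,…,n} \ {l}`),
subject to `φ_{P f} = (φ f)⁻¹`. -/
structure GlueingDatum (n : ℕ) where
  I : Type
  fintypeI : Fintype I
  nonemptyI : Nonempty I
  P : I × Fin (n + 1) → I × Fin (n + 1)
  P_involutive : ∀ f, P (P f) = f
  P_fixedPointFree : ∀ f, P f ≠ f
  glue : I × Fin (n + 1) → Equiv.Perm (Fin (n + 1))
  glue_face : ∀ f, glue f f.2 = (P f).2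
  glue_symm : ∀ f, glue (P f) = (glue f).symm

/-- The permutation of `Fin n` obtained from a permutation `e` of `Fin (n+1)` by
deleting `k` from the source and `e k` from the target, conjugating by the
order-preserving bijections `{0,…,n} \ {k} ≃ {1,…,n}` and `{0,…,n} \ {e k} ≃ {1,…,n}`. -/
def restrictPerm {n : ℕ} (e : Equiv.Perm (Fin (n + 1))) (k : Fin (n + 1)) :
    Equiv.Perm (Fin n) :=
  (finSuccAboveEquiv k).trans
    ((e.subtypeEquiv (fun _ => (not_congr e.apply_eq_iff_eq).symm)).trans
      (finSuccAboveEquiv (e k)).symm)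

/-- The signature of the face-pairing `e` at the face opposite to `k`. -/
def glueSign {n : ℕ} (e : Equiv.Perm (Fin (n + 1))) (k : Fin (n + 1)) : ℤˣ :=
  Equiv.Perm.sign (restrictPerm e k)

/-- Condition Ori: the simplices can be given signs so that every face-pairing
reverses the induced orientation. -/
def Ori {n : ℕ} (D : GlueingDatum n) : Prop :=
  ∃ ε : D.I → ℤˣ, ∀ (i : D.I) (k : Fin (n + 1)),
    ε i * (-1) ^ (k : ℕ) * glueSign (D.glue (i, k)) k
      = -(ε (D.P (i, k)).1 * (-1) ^ (((D.P (i, k)).2 : Fin (n + 1)) : ℕ))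

/-- Condition Dir: the edges of the simplices can be directed compatibly with all the
face-pairings. -/
def Dir {n : ℕ} (D : GlueingDatum n) : Prop :=
  ∃ o : D.I → Fin (n + 1) → Fin (n + 1) → Prop,
    (∀ i a b, a ≠ b → Xor' (o i a b) (o i b a)) ∧
    (∀ (i : D.I) (k a b : Fin (n + 1)), a ≠ k → b ≠ k → a ≠ b →
      (o i a b ↔ o (D.P (i, k)).1 (D.glue (i, k) a) (D.glue (i, k) b)))

/-- The standard `n`-simplex, in barycentric coordinates. -/
abbrev Delta (n : ℕ) : Type :=
  {x : Fin (n + 1) → ℝ // (∀ v, 0 ≤ x v) ∧ ∑ v, x v = 1}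

/-- The disjoint union of the simplices `Δ_i`, `i ∈ I`. -/
abbrev GlueTotal {n : ℕ} (D : GlueingDatum n) : Type := Σ _ : D.I, Delta n

/-- The identifications: for each face `(i,k)` with `P (i,k) = (j,l)`, every point `x`
of the face `(i,k)` (i.e. with `x k = 0`) is identified with the point `y = x ∘ φ⁻¹` of
the face `(j,l)`, which satisfies `y (φ a) = x a` for `a ≠ k` and `y l = 0`. -/
def glueRel {n : ℕ} (D : GlueingDatum n) : GlueTotal D → GlueTotal D → Prop :=
  fun p q => ∃ k : Fin (n + 1), p.2.1 k = 0 ∧ (D.P (p.1, k)).1 = q.1 ∧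
    (q.2.1 : Fin (n + 1) → ℝ) = p.2.1 ∘ ⇑(D.glue (p.1, k)).symm

/-- The glued space `X = S/P`, with the quotient topology. -/
abbrev GlueSpace {n : ℕ} (D : GlueingDatum n) : Type := Quot (glueRel D)

/-- The image in `X` of the vertices of the simplices. -/
def vertexImage {n : ℕ} (D : GlueingDatum n) : Set (GlueSpace D) :=
  {z | ∃ p : GlueTotal D, (∃ v, p.2.1 v = 1) ∧ Quot.mk (glueRel D) p = z}

/-- The space `X* = X ∖ {vertices}`, with the subspace topology. -/
abbrev GlueSpaceStar {n : ℕ} (D : GlueingDatum n) : Type := ↥((vertexImage D)ᶜ)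

/-- Local euclideanness: every point has an open neighborhood homeomorphic to `ℝⁿ`. -/
def LocEuclidean (n : ℕ) (Z : Type) [TopologicalSpace Z] : Prop :=
  ∀ z : Z, ∃ U : Set Z, IsOpen U ∧ z ∈ U ∧
    Nonempty (↥U ≃ₜ EuclideanSpace ℝ (Fin n))

/-- Condition Cycl: for every cycle around a triangle — data of `m ≥ 1`, 4-simplices
`i 0, …, i m`, triangle labelings `t 0, …, t m : Fin 3 → Fin 5` (injections), and faces
`k r ∉ range (t r)` with `P (i r, k r) = (i (r+1), l (r+1))`, `t (r+1) = φ_{(i r, k r)} ∘ t r`,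
`k r ≠ l r` for `0 < r < m`, returning to the start: `i m = i 0`,
`range (t m) = range (t 0)`, `l m ≠ k 0` — the return labeling is the identity:
`t m = t 0`. -/
def Cycl (D : GlueingDatum 4) : Prop :=
  ∀ m : ℕ, 1 ≤ m → ∀ (i : ℕ → D.I) (t : ℕ → Fin 3 → Fin 5) (k l : ℕ → Fin 5),
    (∀ r, r ≤ m → Function.Injective (t r)) →
    (∀ r, r < m → k r ∉ Set.range (t r)) →
    (∀ r, r < m → D.P (i r, k r) = (i (r + 1), l (r + 1))) →
    (∀ r, r < m → t (r + 1) = ⇑(D.glue (i r, k r)) ∘ t r) →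
    (∀ r, 0 < r → r < m → k r ≠ l r) →
    i m = i 0 → Set.range (t m) = Set.range (t 0) → l m ≠ k 0 →
    t m = t 0

/-- The barycentre of the triangle of the standard 4-simplex spanned by the three
vertices in `s`: the point with coordinates `1/3` on `s` and `0` elsewhere. -/
def triangleBarycentre (s : Finset (Fin 5)) (hs : s.card = 3) : Delta 4 :=
  ⟨fun v => if v ∈ s then (1 / 3 : ℝ) else 0, by
    constructor
    · intro v
      dsimp only
      split <;> norm_num
    · simp [Finset.sum_ite_mem, hs]⟩


/-- A continuous map into a space of larger dimension can be pushed off the origin,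
without changing it on a set where it is bounded away from the origin. -/
theorem exists_avoid_zero {F H : Type*} [NormedAddCommGroup F] [NormedSpace ℝ F]
    [FiniteDimensional ℝ F] [NormedAddCommGroup H] [NormedSpace ℝ H] [FiniteDimensional ℝ H]
    (hd : Module.finrank ℝ F < Module.finrank ℝ H) (φ : F → H) (hφ : Continuous φ)
    (C : Set F) (ε : ℝ) (hε : 0 < ε) (hC : ∀ p ∈ C, ε ≤ ‖φ p‖) :
    ∃ φ' : F → H, Continuous φ' ∧ (∀ p, φ' p ≠ 0) ∧ (∀ p ∈ C, φ' p = φ p) ∧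
      ∀ p, dist (φ' p) (φ p) < ε := by
  obtain ⟨g, hg, hgd, -⟩ := hφ.exists_contDiff_approx 1 (ε := fun _ => ε / 3)
    continuous_const (fun _ => by positivity)
  have hdense := ContDiff.dense_compl_range_of_finrank_lt_finrank (f := g) (by exact_mod_cast hg) hd
  obtain ⟨a, ha, had⟩ := hdense.exists_dist_lt 0 (show 0 < ε / 3 by positivity)
  have hgc : Continuous g := hg.continuous
  have han : ‖a‖ < ε / 3 := by simpa [dist_eq_norm] using had
  have hclose : ∀ p, ‖φ p - (g p - a)‖ < 2 * ε / 3 := by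
    intro p
    have h1 := hgd p
    rw [dist_eq_norm] at h1
    calc ‖φ p - (g p - a)‖ = ‖a - (g p - φ p)‖ := by congr 1; abel
      _ ≤ ‖a‖ + ‖g p - φ p‖ := norm_sub_le _ _
      _ < 2 * ε / 3 := by linarith
  have hne : ∀ p, g p - a ≠ 0 := by
    intro p hp
    exact ha ⟨p, sub_eq_zero.mp hp⟩
  let χ : F → ℝ := fun p => min 1 (max 0 ((‖φ p‖ - 2 * ε / 3) / (ε / 3)))
  have hχ0 : ∀ p, 0 ≤ χ p := fun p => le_min zero_le_one (le_max_left _ _)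
  have hχ1 : ∀ p, χ p ≤ 1 := fun p => min_le_left _ _
  have hχc : Continuous χ := by
    dsimp only [χ]
    fun_prop
  refine ⟨fun p => φ p - (1 - χ p) • (φ p - (g p - a)), by fun_prop, ?_, ?_, ?_⟩
  · intro p hp
    by_cases h : 2 * ε / 3 < ‖φ p‖
    · have h1 : ‖(1 - χ p) • (φ p - (g p - a))‖ ≤ 1 * ‖φ p - (g p - a)‖ := by
        rw [norm_smul, Real.norm_eq_abs, abs_of_nonneg (by linarith [hχ1 p])]
        gcongr
        linarith [hχ0 p]
      have h2 : φ p = (1 - χ p) • (φ p - (g p - a)) := sub_eq_zero.mp hp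
      have h3 := hclose p
      rw [← h2] at h1
      linarith
    · have : χ p = 0 := by
        dsimp only [χ]
        rw [max_eq_left, min_eq_right zero_le_one]
        apply div_nonpos_of_nonpos_of_nonneg <;> [linarith; positivity]
      simp only [this, sub_zero, one_smul] at hp
      exact hne p (by simpa using hp)
  · intro p hp
    have : χ p = 1 := by
      dsimp only [χ]
      apply min_eq_left
      apply le_max_of_le_right
      rw [le_div_iff₀ (by positivity)]
      linarith [hC p hp]
    simp [this]
  · intro p
    rw [dist_eq_norm]
    have : φ p - (1 - χ p) • (φ p - (g p - a)) - φ p = - ((1 - χ p) • (φ p - (g p - a))) := by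
      abel
    rw [this, norm_neg, norm_smul, Real.norm_eq_abs, abs_of_nonneg (by linarith [hχ1 p])]
    have := hclose p
    have h0 := norm_nonneg (φ p - (g p - a))
    nlinarith [hχ0 p, hχ1 p]

/-- Radial projection to the closed unit disc. -/
def clampC (z : ℂ) : ℂ := ((max 1 ‖z‖)⁻¹ : ℝ) * z

theorem clampC_continuous : Continuous clampC := by
  unfold clampC
  refine Continuous.mul (Complex.continuous_ofReal.comp ?_) continuous_id
  refine Continuous.inv₀ (by fun_prop) (fun z => ?_)
  have : (1 : ℝ) ≤ max 1 ‖z‖ := le_max_left _ _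
  positivity

theorem clampC_norm (z : ℂ) : ‖clampC z‖ ≤ 1 := by
  unfold clampC
  have : (1 : ℝ) ≤ max 1 ‖z‖ := le_max_left _ _
  rw [norm_mul, Complex.norm_real, Real.norm_of_nonneg (by positivity), inv_mul_le_iff₀ (by positivity)]
  simp

theorem clampC_eq {z : ℂ} (h : ‖z‖ ≤ 1) : clampC z = z := by
  unfold clampC
  simp [h]

theorem clampC_ne {z : ℂ} (h : z ≠ 0) : clampC z ≠ 0 := by
  unfold clampC
  have : (1 : ℝ) ≤ max 1 ‖z‖ := le_max_left _ _
  refine mul_ne_zero ?_ h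
  exact_mod_cast (by positivity : (max 1 ‖z‖)⁻¹ ≠ (0 : ℝ))

theorem clampC_pow {n : ℕ} (hn : n ≠ 0) {z z' : ℂ} (h : z ^ n = z' ^ n) :
    clampC z ^ n = clampC z' ^ n := by
  have : ‖z‖ = ‖z'‖ := by
    have h2 := congrArg norm h
    rw [norm_pow, norm_pow] at h2
    exact (pow_left_inj₀ (norm_nonneg _) (norm_nonneg _) hn).mp h2
  unfold clampC
  rw [mul_pow, mul_pow, h, this]

theorem isOpenMap_cpow {n : ℕ} (hn : n ≠ 0) : IsOpenMap (fun z : ℂ => z ^ n) := by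
  have h : AnalyticOnNhd ℂ (fun z : ℂ => z ^ n) Set.univ := by
    intro z _
    fun_prop
  rcases h.is_constant_or_isOpenMap with ⟨w, hw⟩ | h
  · have h0 := hw 0
    have h1 := hw 1
    simp [hn] at h0 h1
    rw [← h0] at h1
    exact absurd h1 one_ne_zero
  · exact h

theorem exists_pushed_family {S H : Type*} [NormedAddCommGroup S] [NormedSpace ℝ S]
    [FiniteDimensional ℝ S] [NormedAddCommGroup H] [NormedSpace ℝ H] [FiniteDimensional ℝ H]
    (hd : Module.finrank ℝ S + 2 < Module.finrank ℝ H) {n : ℕ} (hn : n ≠ 0)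
    (Φ : ℂ × ℂ → H) (δ r : ℝ) (hr : 0 < r) (hrδ : r < δ)
    (hc : ContinuousOn Φ (Metric.ball 0 δ))
    (ho : ∀ O ⊆ Metric.ball 0 δ, IsOpen O → IsOpen (Φ '' O))
    (h0 : ∀ w ∈ Metric.ball 0 δ, Φ w = 0 → w = 0)
    (j : S → ℂ) (hj : Continuous j) (hjr : ∀ s, ‖j s‖ ≤ r)
    (hinv : ∀ s z z', ‖z‖ ≤ r → z ^ n = z' ^ n → Φ (j s, z) = Φ (j s, z'))
    (C : Set (S × ℂ)) (hCc : IsCompact C) (hC : ∀ p ∈ C, j p.1 ≠ 0 ∨ p.2 ≠ 0) :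
    ∃ φ' : S × ℂ → H, Continuous φ' ∧ (∀ p, φ' p ≠ 0) ∧
      (∀ p, φ' p ∈ Φ '' Metric.ball 0 δ) ∧
      ∀ s z, ‖z‖ ≤ 1 → (s, z ^ n) ∈ C → φ' (s, z ^ n) = Φ (j s, r * z) := by
  have hroot : ∀ w : ℂ, ∃ z : ℂ, z ^ n = w := fun w => IsAlgClosed.exists_pow_nat_eq w (by omega)
  choose ρ hρ using hroot
  let φ : S × ℂ → H := fun p => Φ (j p.1, r * clampC (ρ p.2))
  have hmem : ∀ s z, (j s, (r : ℂ) * clampC z) ∈ Metric.closedBall (0 : ℂ × ℂ) r := by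
    intro s z
    rw [mem_closedBall_zero_iff, Prod.norm_def]
    refine max_le (hjr s) ?_
    simp only [norm_mul, Complex.norm_real, Real.norm_of_nonneg hr.le]
    nlinarith [clampC_norm z]
  have hsub : Metric.closedBall (0 : ℂ × ℂ) r ⊆ Metric.ball 0 δ :=
    Metric.closedBall_subset_ball hrδ
  have hφpow : ∀ s z, φ (s, z ^ n) = Φ (j s, r * clampC z) := by
    intro s z
    apply hinv
    · have := hmem s (ρ (z ^ n))
      rw [mem_closedBall_zero_iff, Prod.norm_def] at this
      exact (le_max_right _ _).trans this
    · rw [mul_pow, mul_pow, clampC_pow hn (hρ (z ^ n))]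
  have hφc : Continuous φ := by
    have hq : Topology.IsQuotientMap (Prod.map (id : S → S) (fun z : ℂ => z ^ n)) := by
      apply IsOpenMap.isQuotientMap
      · exact IsOpenMap.id.prodMap (isOpenMap_cpow hn)
      · exact continuous_id.prodMap (by fun_prop)
      · exact Function.surjective_id.prodMap (fun w => ⟨ρ w, hρ w⟩)
    rw [hq.continuous_iff]
    have : φ ∘ (Prod.map (id : S → S) (fun z : ℂ => z ^ n)) =
        fun p => Φ (j p.1, r * clampC p.2) := by
      funext p
      exact hφpow p.1 p.2
    rw [this]
    refine hc.comp_continuous ?_ (fun p => hsub (hmem _ _))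
    have := clampC_continuous
    fun_prop
  have hφC : ∀ p ∈ C, φ p ≠ 0 := by
    intro p hp hz
    have := h0 _ (hsub (hmem _ _)) hz
    rw [Prod.mk_eq_zero] at this
    rcases hC p hp with h | h
    · exact h this.1
    · have hρ0 : ρ p.2 ≠ 0 := by
        intro h2
        have := hρ p.2
        rw [h2, zero_pow hn] at this
        exact h this.symm
      exact mul_ne_zero (by exact_mod_cast hr.ne') (clampC_ne hρ0) this.2
  obtain ⟨ε1, hε1, heps⟩ : ∃ ε > 0, ∀ p ∈ C, ε ≤ ‖φ p‖ := by
    rcases C.eq_empty_or_nonempty with h | h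
    · exact ⟨1, one_pos, by simp [h]⟩
    · obtain ⟨p, hp, hmin⟩ := hCc.exists_isMinOn h hφc.norm.continuousOn
      exact ⟨‖φ p‖, norm_pos_iff.mpr (hφC p hp), fun q hq => hmin hq⟩
  have hK : IsCompact (Φ '' Metric.closedBall 0 r) :=
    (isCompact_closedBall _ _).image_of_continuousOn (hc.mono hsub)
  obtain ⟨ε2, hε2, hthick⟩ := hK.exists_thickening_subset_open
    (ho _ subset_rfl Metric.isOpen_ball) (Set.image_mono hsub)
  obtain ⟨φ', h1, h2, h3, h4⟩ := exists_avoid_zero (F := S × ℂ) (H := H)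
    (by simpa using hd) φ hφc C (min ε1 ε2) (lt_min hε1 hε2)
    (fun p hp => (min_le_left _ _).trans (heps p hp))
  refine ⟨φ', h1, h2, ?_, ?_⟩
  · intro p
    apply hthick
    rw [Metric.mem_thickening_iff]
    exact ⟨φ p, ⟨_, hmem _ _, rfl⟩, (h4 p).trans_le (min_le_right _ _)⟩
  · intro s z hz hp
    rw [h3 _ hp, hφpow, clampC_eq hz]

theorem grid_two {α A : Type*} [AddCommGroup A] (n : ℕ) (V : ℕ → ℕ → α) (c : α → α → A)
    (hP : ∀ b, V b n = V b 0) (hZ : ∀ e, V 0 e = V 0 0) (hc : ∀ b e, c (V b e) (V b e) = 0)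
    (hsq : ∀ b < n, ∀ e < n, c (V b e) (V (b + 1) e) + c (V (b + 1) e) (V (b + 1) (e + 1)) =
      c (V b e) (V b (e + 1)) + c (V b (e + 1)) (V (b + 1) (e + 1))) :
    ∑ e ∈ Finset.range n, c (V n e) (V n (e + 1)) = 0 := by
  have key : ∀ b ≤ n, ∑ e ∈ Finset.range n, c (V b e) (V b (e + 1)) = 0 := by
    intro b
    induction b with
    | zero =>
      intro _
      apply Finset.sum_eq_zero
      intro e _
      rw [hZ (e + 1), hZ e, hc]
    | succ b ih =>
      intro hb
      have h1 : ∀ e ∈ Finset.range n, c (V (b + 1) e) (V (b + 1) (e + 1)) =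
          c (V b e) (V b (e + 1)) +
            (c (V b (e + 1)) (V (b + 1) (e + 1)) - c (V b e) (V (b + 1) e)) := by
        intro e he
        have := hsq b (by omega) e (Finset.mem_range.mp he)
        rw [← add_sub_assoc, ← this]
        abel
      rw [Finset.sum_congr rfl h1, Finset.sum_add_distrib, ih (by omega),
        Finset.sum_range_sub (fun e => c (V b e) (V (b + 1) e)), hP, hP]
      simp
  exact key n le_rfl

/-- The coboundary of the cochain `c` on a square. -/
def sqd {α A : Type*} [AddCommGroup A] (c : α → α → A) (p q r s : α) : A :=
  c p q + c q s - c p r - c r s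

theorem grid_three {α A : Type*} [AddCommGroup A] (n : ℕ) (V : ℕ → ℕ → ℕ → α) (c : α → α → A)
    (up : α → Prop)
    (hP : ∀ a b, V a b n = V a b 0) (hZ : ∀ a e, V a 0 e = V a 0 0)
    (hc : ∀ a b e, c (V a b e) (V a b e) = 0)
    (hcube : ∀ a < n, ∀ b < n, ∀ e < n,
      (∀ i ≤ 1, ∀ j ≤ 1, ∀ k ≤ 1, up (V (a + i) (b + j) (e + k))) ∨
      (∀ i ≤ 1, ∀ j ≤ 1, ∀ k ≤ 1, ¬ up (V (a + i) (b + j) (e + k))) ∨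
      ∃ ε : α → A, ∀ i ≤ 1, ∀ j ≤ 1, ∀ k ≤ 1, ∀ i' ≤ 1, ∀ j' ≤ 1, ∀ k' ≤ 1,
        c (V (a + i) (b + j) (e + k)) (V (a + i') (b + j') (e + k')) =
          ε (V (a + i') (b + j') (e + k')) - ε (V (a + i) (b + j) (e + k)))
    (htop : ∀ b ≤ n, ∀ e ≤ n, up (V n b e)) (hbot : ∀ b ≤ n, ∀ e ≤ n, ¬ up (V 0 b e))
    (ε : ℕ → ℕ → A)
    (hout1 : ∀ a ≤ n, ∀ e < n, c (V a n e) (V a n (e + 1)) = ε a (e + 1) - ε a e)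
    (hout2 : ∀ a < n, ∀ e ≤ n, c (V a n e) (V (a + 1) n e) = ε (a + 1) e - ε a e) :
    ε n n = ε n 0 := by
  let Fbe : ℕ → ℕ → ℕ → A := fun a b e =>
    sqd c (V a b e) (V a (b + 1) e) (V a b (e + 1)) (V a (b + 1) (e + 1))
  let Fae : ℕ → ℕ → ℕ → A := fun a b e =>
    sqd c (V a b e) (V (a + 1) b e) (V a b (e + 1)) (V (a + 1) b (e + 1))
  let Fab : ℕ → ℕ → ℕ → A := fun a b e =>
    sqd c (V a b e) (V (a + 1) b e) (V a (b + 1) e) (V (a + 1) (b + 1) e)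
  let G : (ℕ → ℕ → ℕ → A) → ℕ → ℕ → ℕ → A := fun F a b e => if up (V a b e) then F a b e else 0
  have hcl : ∀ a < n, ∀ b < n, ∀ e < n,
      G Fbe (a + 1) b e = G Fbe a b e + ((G Fae a (b + 1) e - G Fae a b e)
        - (G Fab a b (e + 1) - G Fab a b e)) := by
    intro a ha b hb e he
    rcases hcube a ha b hb e he with h | h | ⟨η, h⟩
    · have h000 := h 0 zero_le_one 0 zero_le_one 0 zero_le_one
      have h100 := h 1 le_rfl 0 zero_le_one 0 zero_le_one
      have h010 := h 0 zero_le_one 1 le_rfl 0 zero_le_one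
      have h001 := h 0 zero_le_one 0 zero_le_one 1 le_rfl
      simp only [add_zero] at h000 h100 h010 h001
      simp only [G, Fbe, Fae, Fab, sqd, h000, h100, h010, h001, if_true]
      abel
    · have h000 := h 0 zero_le_one 0 zero_le_one 0 zero_le_one
      have h100 := h 1 le_rfl 0 zero_le_one 0 zero_le_one
      have h010 := h 0 zero_le_one 1 le_rfl 0 zero_le_one
      have h001 := h 0 zero_le_one 0 zero_le_one 1 le_rfl
      simp only [add_zero] at h000 h100 h010 h001
      simp only [G, h000, h100, h010, h001, if_false]
      abel
    · have hz : ∀ i ≤ 1, ∀ j ≤ 1, ∀ k ≤ 1, ∀ i₂ ≤ 1, ∀ j₂ ≤ 1, ∀ k₂ ≤ 1,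
          ∀ i₃ ≤ 1, ∀ j₃ ≤ 1, ∀ k₃ ≤ 1, ∀ i₄ ≤ 1, ∀ j₄ ≤ 1, ∀ k₄ ≤ 1,
          sqd c (V (a + i) (b + j) (e + k)) (V (a + i₂) (b + j₂) (e + k₂))
            (V (a + i₃) (b + j₃) (e + k₃)) (V (a + i₄) (b + j₄) (e + k₄)) = 0 := by
        intro i hi j hj k hk i₂ hi₂ j₂ hj₂ k₂ hk₂ i₃ hi₃ j₃ hj₃ k₃ hk₃ i₄ hi₄ j₄ hj₄ k₄ hk₄
        unfold sqd
        rw [h i hi j hj k hk i₂ hi₂ j₂ hj₂ k₂ hk₂, h i hi j hj k hk i₃ hi₃ j₃ hj₃ k₃ hk₃,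
          h i₂ hi₂ j₂ hj₂ k₂ hk₂ i₄ hi₄ j₄ hj₄ k₄ hk₄, h i₃ hi₃ j₃ hj₃ k₃ hk₃ i₄ hi₄ j₄ hj₄ k₄ hk₄]
        abel
      have z := zero_le_one (α := ℕ)
      have o := le_refl 1
      have e1 : Fbe (a + 1) b e = 0 :=
        hz 1 o 0 z 0 z 1 o 1 o 0 z 1 o 0 z 1 o 1 o 1 o 1 o
      have e2 : Fbe a b e = 0 :=
        hz 0 z 0 z 0 z 0 z 1 o 0 z 0 z 0 z 1 o 0 z 1 o 1 o
      have e3 : Fae a (b + 1) e = 0 :=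
        hz 0 z 1 o 0 z 1 o 1 o 0 z 0 z 1 o 1 o 1 o 1 o 1 o
      have e4 : Fae a b e = 0 :=
        hz 0 z 0 z 0 z 1 o 0 z 0 z 0 z 0 z 1 o 1 o 0 z 1 o
      have e5 : Fab a b (e + 1) = 0 :=
        hz 0 z 0 z 1 o 1 o 0 z 1 o 0 z 1 o 1 o 1 o 1 o 1 o
      have e6 : Fab a b e = 0 :=
        hz 0 z 0 z 0 z 1 o 0 z 0 z 0 z 1 o 0 z 1 o 1 o 0 z
      simp [G, e1, e2, e3, e4, e5, e6]
  have hQ : ∀ a ≤ n, ∑ b ∈ Finset.range n, ∑ e ∈ Finset.range n, G Fbe a b e = 0 := by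
    intro a
    induction a with
    | zero =>
      intro _
      refine Finset.sum_eq_zero fun b hb => Finset.sum_eq_zero fun e he => ?_
      simp only [Finset.mem_range] at hb he
      simp [G, hbot b (by omega) e (by omega)]
    | succ a ih =>
      intro ha
      have h1 : ∑ b ∈ Finset.range n, ∑ e ∈ Finset.range n, G Fbe (a + 1) b e =
          ∑ b ∈ Finset.range n, ∑ e ∈ Finset.range n,
           (G Fbe a b e + ((G Fae a (b + 1) e - G Fae a b e)
              - (G Fab a b (e + 1) - G Fab a b e))) := by
        refine Finset.sum_congr rfl fun b hb => Finset.sum_congr rfl fun e he => ?_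
        exact hcl a (by omega) b (Finset.mem_range.mp hb) e (Finset.mem_range.mp he)
      have h2 : ∑ b ∈ Finset.range n, ∑ e ∈ Finset.range n,
          (G Fae a (b + 1) e - G Fae a b e) = 0 := by
        rw [Finset.sum_comm]
        refine Finset.sum_eq_zero fun e he => ?_
        have he' := Finset.mem_range.mp he
        rw [Finset.sum_range_sub (fun b => G Fae a b e)]
        have h3 : Fae a n e = 0 := by
          simp only [Fae, sqd]
          rw [hout1 a (by omega) e he', hout1 (a + 1) (by omega) e he',
            hout2 a (by omega) e (by omega), hout2 a (by omega) (e + 1) (by omega)]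
          abel
        have h4 : Fae a 0 e = 0 := by
          simp only [Fae, sqd]
          rw [hZ a (e + 1), hZ (a + 1) (e + 1), hZ a e, hZ (a + 1) e, hc, hc]
          abel
        simp [G, h3, h4]
      have h5 : ∑ b ∈ Finset.range n, ∑ e ∈ Finset.range n,
          (G Fab a b (e + 1) - G Fab a b e) = 0 := by
        refine Finset.sum_eq_zero fun b hb => ?_
        rw [Finset.sum_range_sub (fun e => G Fab a b e)]
        simp [G, Fab, hP]
      rw [h1]
      simp only [Finset.sum_add_distrib, Finset.sum_sub_distrib] at h2 h5 ⊢
      rw [ih (by omega), h2, h5]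
      simp
  have hlast := hQ n le_rfl
  have h6 : ∑ b ∈ Finset.range n, ∑ e ∈ Finset.range n, G Fbe n b e =
      ∑ b ∈ Finset.range n, ∑ e ∈ Finset.range n,
        ((c (V n (b + 1) e) (V n (b + 1) (e + 1)) - c (V n b e) (V n b (e + 1))) -
        (c (V n b (e + 1)) (V n (b + 1) (e + 1)) - c (V n b e) (V n (b + 1) e))) := by
    refine Finset.sum_congr rfl fun b hb => Finset.sum_congr rfl fun e he => ?_
    simp only [Finset.mem_range] at hb he
    simp only [G, Fbe, sqd, htop b (by omega) e (by omega), if_true]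
    abel
  rw [h6] at hlast
  simp only [Finset.sum_sub_distrib (s := Finset.range n)] at hlast
  have h7 : ∑ b ∈ Finset.range n, (∑ e ∈ Finset.range n, c (V n b (e + 1)) (V n (b + 1) (e + 1))
      - ∑ e ∈ Finset.range n, c (V n b e) (V n (b + 1) e)) = 0 := by
    refine Finset.sum_eq_zero fun b hb => ?_
    rw [← Finset.sum_sub_distrib, Finset.sum_range_sub (fun e => c (V n b e) (V n (b + 1) e)), hP, hP,
      sub_self]
  rw [Finset.sum_sub_distrib] at h7
  rw [h7, sub_zero, ← Finset.sum_sub_distrib,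
    Finset.sum_range_sub (fun b => ∑ e ∈ Finset.range n, c (V n b e) (V n b (e + 1)))] at hlast
  have h8 : ∑ e ∈ Finset.range n, c (V n 0 e) (V n 0 (e + 1)) = 0 := by
    refine Finset.sum_eq_zero fun e he => ?_
    rw [hZ n (e + 1), hZ n e, hc]
  have h9 : ∑ e ∈ Finset.range n, c (V n n e) (V n n (e + 1)) = ε n n - ε n 0 := by
    rw [← Finset.sum_range_sub (fun e => ε n e)]
    refine Finset.sum_congr rfl fun e he => hout1 n le_rfl e (Finset.mem_range.mp he)
  rw [h8, h9, sub_zero] at hlast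
  exact sub_eq_zero.mp hlast

/-- A fine grid subordinate to an open cover. -/
theorem exists_fine_grid {ι : Type*} (c : ι → Set (ℝ × ℝ × ℝ)) (hc : ∀ i, IsOpen (c i))
    (hcov : ∀ p, ∃ i, p ∈ c i) :
    ∃ n : ℕ, 9 ≤ n ∧ ∀ a < n, ∀ b < n, ∀ e < n, ∃ i, ∀ x ≤ 1, ∀ y ≤ 1, ∀ z ≤ 1,
      ((-1 + 2 * ((a + x : ℕ) : ℝ) / n, ((b + y : ℕ) : ℝ) / n, ((e + z : ℕ) : ℝ) / n) :
        ℝ × ℝ × ℝ) ∈ c i := by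
  obtain ⟨δ, hδ, hL⟩ := lebesgue_number_lemma_of_metric
    (s := Set.Icc (-1 : ℝ) 1 ×ˢ (Set.Icc (0 : ℝ) 1 ×ˢ Set.Icc (0 : ℝ) 1))
    (isCompact_Icc.prod (isCompact_Icc.prod isCompact_Icc)) hc
    (fun p _ => Set.mem_iUnion.mpr (hcov p))
  obtain ⟨n, hn⟩ := exists_nat_gt (max 9 (2 / δ))
  have hn3 : (9 : ℝ) < n := (le_max_left _ _).trans_lt hn
  have hnδ : 2 / δ < n := (le_max_right _ _).trans_lt hn
  have hnpos : (0 : ℝ) < n := by linarith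
  have h2 : 2 / (n : ℝ) < δ := by
    rw [div_lt_iff₀ hδ] at hnδ
    rw [div_lt_iff₀ hnpos]
    linarith
  refine ⟨n, by exact_mod_cast hn3.le, ?_⟩
  intro a ha b hb e he
  have ha' : (a : ℝ) ≤ n := by exact_mod_cast ha.le
  have hb' : (b : ℝ) ≤ n := by exact_mod_cast hb.le
  have he' : (e : ℝ) ≤ n := by exact_mod_cast he.le
  have hda : (a : ℝ) / n ≤ 1 := (div_le_one hnpos).mpr ha'
  have hda0 : 0 ≤ (a : ℝ) / n := by positivity
  obtain ⟨i, hi⟩ := hL (-1 + 2 * (a : ℝ) / n, (b : ℝ) / n, (e : ℝ) / n) (by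
    refine ⟨⟨?_, ?_⟩, ⟨by positivity, (div_le_one hnpos).mpr hb'⟩,
      ⟨by positivity, (div_le_one hnpos).mpr he'⟩⟩
    · show -1 ≤ -1 + 2 * (a : ℝ) / n
      rw [mul_div_assoc]; linarith
    · show -1 + 2 * (a : ℝ) / n ≤ 1
      rw [mul_div_assoc]; linarith)
  refine ⟨i, fun x hx y hy z hz => hi ?_⟩
  have hx' : (x : ℝ) ≤ 1 := by exact_mod_cast hx
  have hy' : (y : ℝ) ≤ 1 := by exact_mod_cast hy
  have hz' : (z : ℝ) ≤ 1 := by exact_mod_cast hz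
  have hbd : ∀ (u k : ℝ), 0 ≤ k → k ≤ 2 → |(u + k) / n - u / n| < δ := by
    intro u k hk0 hk
    have : (u + k) / n - u / n = k / n := by ring
    rw [this, abs_of_nonneg (by positivity)]
    exact (div_le_div_of_nonneg_right hk hnpos.le).trans_lt h2
  rw [Metric.mem_ball, Prod.dist_eq, Prod.dist_eq]
  refine max_lt ?_ (max_lt ?_ ?_)
  · rw [Real.dist_eq]
    have h3 := hbd (2 * a) (2 * x) (by positivity) (by linarith)
    have : (-1 + 2 * ((a + x : ℕ) : ℝ) / n) - (-1 + 2 * (a : ℝ) / n) =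
      (2 * a + 2 * x) / n - 2 * a / n := by push_cast; ring
    rw [this]; exact h3
  · rw [Real.dist_eq]
    have h3 := hbd b y (by positivity) (by linarith)
    push_cast; exact h3
  · rw [Real.dist_eq]
    have h3 := hbd e z (by positivity) (by linarith)
    push_cast; exact h3

/-- The sign-change form used in the order two case. -/
def ipTwo (p q : ℂ × ℂ) : ℝ := p.1.im * q.1.im + (p.2.re * q.2.re + p.2.im * q.2.im)

/-- The involution of the order two case. -/
def tauTwo (p : ℂ × ℂ) : ℂ × ℂ := (starRingEnd ℂ p.1, -p.2)

def cTwo (p q : ℂ × ℂ) : ZMod 2 := if ipTwo p q < 0 then 1 else 0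

theorem ipTwo_self (p : ℂ × ℂ) : 0 ≤ ipTwo p p := by
  unfold ipTwo
  nlinarith [mul_self_nonneg p.1.im, mul_self_nonneg p.2.re, mul_self_nonneg p.2.im]

theorem ipTwo_tau_left (p q : ℂ × ℂ) : ipTwo (tauTwo p) q = - ipTwo p q := by
  simp [ipTwo, tauTwo]; ring

theorem ipTwo_tau_right (p q : ℂ × ℂ) : ipTwo p (tauTwo q) = - ipTwo p q := by
  simp [ipTwo, tauTwo]; ring

theorem cTwo_self (p : ℂ × ℂ) : cTwo p p = 0 := by
  simp [cTwo, ipTwo_self]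

theorem cTwo_eq {x x' l l' : ℂ × ℂ} {E E' : ZMod 2}
    (h : (x = l ∧ E = 0) ∨ (x = tauTwo l ∧ E = 1))
    (h' : (x' = l' ∧ E' = 0) ∨ (x' = tauTwo l' ∧ E' = 1)) (hp : 0 < ipTwo l l') :
    cTwo x x' = E' - E := by
  rcases h with ⟨rfl, rfl⟩ | ⟨rfl, rfl⟩ <;> rcases h' with ⟨rfl, rfl⟩ | ⟨rfl, rfl⟩ <;>
    simp only [cTwo, ipTwo_tau_left, ipTwo_tau_right, neg_neg]
  · simp [hp.le]
  · simp [hp]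
  · simp [hp]
  · simp [hp.le]

theorem continuous_ipTwo : Continuous (fun p : (ℂ × ℂ) × (ℂ × ℂ) => ipTwo p.1 p.2) := by
  unfold ipTwo
  fun_prop

theorem exists_pos_nhd {f : (ℂ × ℂ) × (ℂ × ℂ) → Prop} (hf : IsOpen {p | f p}) (e : ℂ × ℂ)
    (he : f (e, e)) : ∃ N : Set (ℂ × ℂ), IsOpen N ∧ e ∈ N ∧ ∀ x ∈ N, ∀ y ∈ N, f (x, y) := by
  obtain ⟨u, v, hu, hv, h1, h2, h3⟩ := isOpen_prod_iff.mp hf e e he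
  exact ⟨u ∩ v, hu.inter hv, ⟨h1, h2⟩, fun x hx y hy => h3 ⟨hx.1, hy.2⟩⟩

theorem no_chart_two {H : Type*} [NormedAddCommGroup H] [NormedSpace ℝ H]
    [FiniteDimensional ℝ H] (hH : Module.finrank ℝ H = 4) (Φ : ℂ × ℂ → H) (δ : ℝ) (hδ : 0 < δ)
    (hc : ContinuousOn Φ (Metric.ball 0 δ))
    (ho : ∀ O ⊆ Metric.ball 0 δ, IsOpen O → IsOpen (Φ '' O)) (hΦ0 : Φ 0 = 0)
    (hfib : ∀ w ∈ Metric.ball (0 : ℂ × ℂ) δ, ∀ w' ∈ Metric.ball (0 : ℂ × ℂ) δ,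
      (Φ w = Φ w' ↔ w' = w ∨ w' = tauTwo w)) : False := by
  set r : ℝ := δ / 2 with hrdef
  have hr : 0 < r := by positivity
  have hrδ : r < δ := by linarith
  have h0mem : (0 : ℂ × ℂ) ∈ Metric.ball 0 δ := Metric.mem_ball_self hδ
  have hmemb : ∀ a b : ℂ, ‖a‖ ≤ r → ‖b‖ ≤ r → (a, b) ∈ Metric.ball (0 : ℂ × ℂ) δ := by
    intro a b ha hb
    rw [mem_ball_zero_iff, Prod.norm_def]
    exact max_lt (ha.trans_lt hrδ) (hb.trans_lt hrδ)
  let j : ℝ → ℂ := fun s => ((r * max (-1) (min 1 s) : ℝ) : ℂ)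
  have hj : Continuous j := by
    dsimp only [j]
    fun_prop
  have hjr : ∀ s, ‖j s‖ ≤ r := by
    intro s
    simp only [j, Complex.norm_real, Real.norm_eq_abs, abs_mul, abs_of_pos hr]
    have : |max (-1) (min 1 s)| ≤ 1 :=
      abs_le.mpr ⟨le_max_left _ _, max_le (by norm_num) (min_le_left _ _)⟩
    nlinarith
  have hjval : ∀ s, s ∈ Set.Icc (-1 : ℝ) 1 → j s = ((r * s : ℝ) : ℂ) := by
    intro s hs
    simp only [j, min_eq_right hs.2, max_eq_right hs.1]
  have hjconj : ∀ s, starRingEnd ℂ (j s) = j s := fun s => Complex.conj_ofReal _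
  have hinv : ∀ s z z', ‖z‖ ≤ r → z ^ 2 = z' ^ 2 → Φ (j s, z) = Φ (j s, z') := by
    intro s z z' hz h
    have h2 := sq_eq_sq_iff_eq_or_eq_neg.mp h
    have hz' : ‖z'‖ ≤ r := by
      rcases h2 with h2 | h2 <;> rw [h2] at hz <;> simpa using hz
    rw [hfib _ (hmemb _ _ (hjr s) hz) _ (hmemb _ _ (hjr s) hz')]
    rcases h2 with h2 | h2
    · left; rw [h2]
    · right; simp [tauTwo, hjconj, h2]
  let C : Set (ℝ × ℂ) := (Set.Icc (-1 : ℝ) 1 ×ˢ Metric.closedBall (0 : ℂ) 1) ∩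
    {p | |p.1| = 1 ∨ ‖p.2‖ = 1}
  have hCc : IsCompact C := by
    refine (isCompact_Icc.prod (isCompact_closedBall _ _)).inter_right ?_
    exact (isClosed_eq (by fun_prop) continuous_const).union
      (isClosed_eq (by fun_prop) continuous_const)
  have hC : ∀ p ∈ C, j p.1 ≠ 0 ∨ p.2 ≠ 0 := by
    rintro ⟨s, w⟩ ⟨⟨h1, h2⟩, h3⟩
    rcases h3 with h3 | h3
    · left
      simp only at h1 h3 ⊢
      rw [hjval s h1]
      have : s ≠ 0 := by rintro rfl; simp at h3
      exact_mod_cast mul_ne_zero hr.ne' this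
    · right
      simp only at h3 ⊢
      rintro rfl
      simp at h3
  obtain ⟨φ', hφc, hφ0, hφm, hφC⟩ := exists_pushed_family (S := ℝ) (H := H)
    (by rw [hH]; simp) two_ne_zero Φ δ r hr hrδ hc ho
    (by
      intro w hw h
      rw [← hΦ0] at h
      rcases (hfib w hw 0 h0mem).mp h with h | h
      · exact h.symm
      · simp only [tauTwo, Prod.ext_iff, Prod.fst_zero, Prod.snd_zero] at h
        ext1
        · simpa using h.1.symm
        · simpa using h.2.symm)
    j hj hjr hinv C hCc hC
  choose u hub hu using hφm
  have hune : ∀ p, u p ≠ 0 := by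
    intro p hp
    apply hφ0 p
    rw [← hu, hp, hΦ0]
  have hloc : ∀ p : ℝ × ℂ, ∃ O : Set (ℝ × ℂ), (IsOpen O ∧ p ∈ O) ∧
      ((∀ q ∈ O, 0 < (u q).1.re) ∨ (∀ q ∈ O, ¬ 0 < (u q).1.re) ∨
        ∃ ε : ℂ × ℂ → ZMod 2, ∀ q ∈ O, ∀ q' ∈ O, cTwo (u q) (u q') = ε (u q') - ε (u q)) := by
    intro p
    have key : ∀ N : Set (ℂ × ℂ), IsOpen N → u p ∈ N →
        (IsOpen (φ' ⁻¹' (Φ '' (N ∩ Metric.ball 0 δ))) ∧ p ∈ φ' ⁻¹' (Φ '' (N ∩ Metric.ball 0 δ))) ∧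
        ∀ q ∈ φ' ⁻¹' (Φ '' (N ∩ Metric.ball 0 δ)), u q ∈ N ∨ ∃ w ∈ N, u q = tauTwo w := by
      intro N hN hp
      refine ⟨⟨(ho _ Set.inter_subset_right (hN.inter Metric.isOpen_ball)).preimage hφc,
        u p, ⟨hp, hub p⟩, hu p⟩, ?_⟩
      rintro q ⟨w, ⟨hw, hwb⟩, hwq⟩
      rw [← hu q] at hwq
      rcases (hfib w hwb (u q) (hub q)).mp hwq with h | h
      · left; rw [h]; exact hw
      · exact Or.inr ⟨w, hw, h⟩
    rcases lt_trichotomy (u p).1.re 0 with h | h | h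
    · obtain ⟨h1, h2⟩ := key {w | w.1.re < 0} (isOpen_lt (by fun_prop) continuous_const) h
      refine ⟨_, h1, Or.inr (Or.inl ?_)⟩
      intro q hq
      rcases h2 q hq with h3 | ⟨w, h3, h4⟩
      · exact not_lt.mpr (le_of_lt h3)
      · rw [h4]
        simp only [tauTwo, Complex.conj_re]
        exact not_lt.mpr (le_of_lt h3)
    · have hpos : 0 < ipTwo (u p) (u p) := by
        refine lt_of_le_of_ne (ipTwo_self _) (fun h0 => hune p ?_)
        unfold ipTwo at h0
        have e1 : (u p).1.im = 0 := by
          nlinarith [mul_self_nonneg (u p).1.im, mul_self_nonneg (u p).2.re,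
            mul_self_nonneg (u p).2.im]
        have e2 : (u p).2.re = 0 := by
          nlinarith [mul_self_nonneg (u p).1.im, mul_self_nonneg (u p).2.re,
            mul_self_nonneg (u p).2.im]
        have e3 : (u p).2.im = 0 := by
          nlinarith [mul_self_nonneg (u p).1.im, mul_self_nonneg (u p).2.re,
            mul_self_nonneg (u p).2.im]
        ext1
        · exact Complex.ext h e1
        · exact Complex.ext e2 e3
      obtain ⟨N, hN, hpN, hNN⟩ := exists_pos_nhd (f := fun p => 0 < ipTwo p.1 p.2)
        (isOpen_lt continuous_const continuous_ipTwo) (u p) hpos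
      obtain ⟨h1, h2⟩ := key N hN hpN
      refine ⟨_, h1, Or.inr (Or.inr ⟨fun x => if x ∈ N then 0 else 1, ?_⟩)⟩
      have h3 : ∀ q ∈ φ' ⁻¹' (Φ '' (N ∩ Metric.ball 0 δ)), ∃ w ∈ N,
          (u q = w ∧ (if u q ∈ N then (0 : ZMod 2) else 1) = 0) ∨
          (u q = tauTwo w ∧ (if u q ∈ N then (0 : ZMod 2) else 1) = 1) := by
        intro q hq
        by_cases h4 : u q ∈ N
        · exact ⟨u q, h4, Or.inl ⟨rfl, if_pos h4⟩⟩
        · rcases h2 q hq with h5 | ⟨w, hw, h5⟩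
          · exact absurd h5 h4
          · exact ⟨w, hw, Or.inr ⟨h5, if_neg h4⟩⟩
      intro q hq q' hq'
      obtain ⟨w, hw, hw2⟩ := h3 q hq
      obtain ⟨w', hw', hw2'⟩ := h3 q' hq'
      exact cTwo_eq hw2 hw2' (hNN w hw w' hw')
    · obtain ⟨h1, h2⟩ := key {w | 0 < w.1.re} (isOpen_lt continuous_const (by fun_prop)) h
      refine ⟨_, h1, Or.inl ?_⟩
      intro q hq
      rcases h2 q hq with h3 | ⟨w, h3, h4⟩
      · exact h3
      · rw [h4]
        simp only [tauTwo, Complex.conj_re]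
        exact h3
  choose O hO hOgood using hloc
  let P : ℝ × ℝ × ℝ → ℝ × ℂ := fun q => (q.1, (q.2.1 : ℂ) * Complex.exp (2 * Real.pi * q.2.2 * Complex.I))
  have hPc : Continuous P := by
    dsimp only [P]
    fun_prop
  obtain ⟨n, hn9, hgrid⟩ := exists_fine_grid (fun p => P ⁻¹' (O p))
    (fun p => (hO p).1.preimage hPc) (fun q => ⟨P q, (hO (P q)).2⟩)
  have hnpos : (0 : ℝ) < n := by exact_mod_cast (by omega : 0 < n)
  have hn0 : (n : ℂ) ≠ 0 := by exact_mod_cast hnpos.ne'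
  let V : ℕ → ℕ → ℕ → ℂ × ℂ := fun a b e => u (P (-1 + 2 * (a : ℝ) / n, (b : ℝ) / n, (e : ℝ) / n))
  have hsmem : ∀ a ≤ n, (-1 + 2 * (a : ℝ) / n) ∈ Set.Icc (-1 : ℝ) 1 := by
    intro a ha
    have h1 : (a : ℝ) / n ≤ 1 := (div_le_one hnpos).mpr (by exact_mod_cast ha)
    have h0 : 0 ≤ (a : ℝ) / n := by positivity
    rw [mul_div_assoc]
    constructor <;> linarith
  have hexpn : ∀ x : ℝ, ‖Complex.exp (2 * Real.pi * x * Complex.I)‖ = 1 := by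
    intro x
    have := Complex.norm_exp_ofReal_mul_I (2 * Real.pi * x)
    push_cast at this
    exact this
  -- boundary values
  have hbdry : ∀ s w, (s, w) ∈ C → ∀ z : ℂ, ‖z‖ ≤ 1 → z ^ 2 = w →
      u (s, w) = (j s, r * z) ∨ u (s, w) = tauTwo (j s, r * z) := by
    intro s w hsw z hz hzw
    have h1 := hφC s z hz (by rw [hzw]; exact hsw)
    rw [hzw, ← hu] at h1
    refine (hfib _ (hmemb _ _ (hjr s) ?_) _ (hub _)).mp h1.symm
    rw [norm_mul, Complex.norm_real, Real.norm_of_nonneg hr.le]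
    nlinarith
  have hre : ∀ s w, (s, w) ∈ C → (u (s, w)).1.re = r * s := by
    intro s w hsw
    obtain ⟨z, hz⟩ := IsAlgClosed.exists_pow_nat_eq w (n := 2) (by norm_num)
    have hz1 : ‖z‖ ≤ 1 := by
      have h1 : ‖w‖ ≤ 1 := by simpa using hsw.1.2
      rw [← hz, norm_pow] at h1
      nlinarith [norm_nonneg z]
    have hs := hjval s hsw.1.1
    rcases hbdry s w hsw z hz1 hz with h | h <;> rw [h]
    · simp [hs]
    · simp [tauTwo, hs]
  have hPC : ∀ s ∈ Set.Icc (-1 : ℝ) 1, ∀ b ≤ n, ∀ x : ℝ, (|s| = 1 ∨ b = n) →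
      P (s, (b : ℝ) / n, x) ∈ C := by
    intro s hs b hb x h
    have hb1 : (b : ℝ) / n ≤ 1 := (div_le_one hnpos).mpr (by exact_mod_cast hb)
    have hnorm : ‖(((b : ℝ) / n : ℝ) : ℂ) * Complex.exp (2 * Real.pi * x * Complex.I)‖ = b / n := by
      rw [norm_mul, hexpn, mul_one, Complex.norm_real, Real.norm_of_nonneg (by positivity)]
    refine ⟨⟨hs, ?_⟩, ?_⟩
    · rw [mem_closedBall_zero_iff]
      exact hnorm.le.trans hb1
    · rcases h with h | h
      · exact Or.inl h
      · right
        show ‖(((b : ℝ) / n : ℝ) : ℂ) * Complex.exp (2 * Real.pi * x * Complex.I)‖ = 1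
        rw [hnorm, h, div_self hnpos.ne']
  let ell : ℕ → ℕ → ℂ × ℂ := fun a e =>
    (j (-1 + 2 * (a : ℝ) / n), r * Complex.exp (((Real.pi * ((e : ℝ) / n) : ℝ) : ℂ) * Complex.I))
  have hVell : ∀ a ≤ n, ∀ e, V a n e = ell a e ∨ V a n e = tauTwo (ell a e) := by
    intro a ha e
    have h1 := hPC _ (hsmem a ha) n le_rfl ((e : ℝ) / n) (Or.inr rfl)
    refine hbdry _ _ h1 (Complex.exp (((Real.pi * ((e : ℝ) / n) : ℝ) : ℂ) * Complex.I)) ?_ ?_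
    · rw [Complex.norm_exp_ofReal_mul_I]
    · rw [← Complex.exp_nat_mul]
      simp only [div_self hnpos.ne', Complex.ofReal_one, one_mul]
      congr 1
      push_cast
      ring
  have hip : ∀ a a' e e', ipTwo (ell a e) (ell a' e') =
      r ^ 2 * Real.cos (Real.pi * ((e : ℝ) / n) - Real.pi * ((e' : ℝ) / n)) := by
    intro a a' e e'
    rw [Real.cos_sub]
    simp only [ipTwo, ell, j, Complex.ofReal_im, Complex.re_ofReal_mul, Complex.im_ofReal_mul,
      Complex.exp_ofReal_mul_I_re, Complex.exp_ofReal_mul_I_im]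
    ring
  have hip0 : ∀ a a' e, 0 < ipTwo (ell a e) (ell a' e) := by
    intro a a' e
    rw [hip, sub_self, Real.cos_zero]
    positivity
  have hip1 : ∀ a e, 0 < ipTwo (ell a e) (ell a (e + 1)) := by
    intro a e
    rw [hip]
    have h1 : Real.pi * ((e : ℝ) / n) - Real.pi * (((e + 1 : ℕ) : ℝ) / n) = - (Real.pi / n) := by
      push_cast; ring
    rw [h1, Real.cos_neg]
    have h2 : 0 < Real.cos (Real.pi / n) := by
      apply Real.cos_pos_of_mem_Ioo
      have hp := Real.pi_pos
      have : Real.pi / n < Real.pi / 2 := by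
        apply div_lt_div_of_pos_left hp (by norm_num)
        exact_mod_cast (by omega : 2 < n)
      have h3 : 0 < Real.pi / n := by positivity
      constructor <;> linarith
    positivity
  let ε : ℕ → ℕ → ZMod 2 := fun a e => if V a n e = ell a e then 0 else 1
  have hε : ∀ a ≤ n, ∀ e, (V a n e = ell a e ∧ ε a e = 0) ∨ (V a n e = tauTwo (ell a e) ∧ ε a e = 1) := by
    intro a ha e
    by_cases h : V a n e = ell a e
    · exact Or.inl ⟨h, if_pos h⟩
    · exact Or.inr ⟨(hVell a ha e).resolve_left h, if_neg h⟩
  have hVP : ∀ a b, V a b n = V a b 0 := by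
    intro a b
    simp only [V, P]
    congr 3
    simp [div_self hnpos.ne', Complex.exp_two_pi_mul_I]
  have hfinal := grid_three n V cTwo (fun x => 0 < x.1.re) hVP
    (by
      intro a e
      simp [V, P])
    (fun a b e => cTwo_self _)
    (by
      intro a ha b hb e he
      obtain ⟨p, hp⟩ := hgrid a ha b hb e he
      rcases hOgood p with h | h | ⟨η, h⟩
      · exact Or.inl fun x hx y hy z hz => h _ (hp x hx y hy z hz)
      · exact Or.inr (Or.inl fun x hx y hy z hz => h _ (hp x hx y hy z hz))
      · exact Or.inr (Or.inr ⟨η, fun x hx y hy z hz x' hx' y' hy' z' hz' =>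
          h _ (hp x hx y hy z hz) _ (hp x' hx' y' hy' z' hz')⟩))
    (by
      intro b hb e he
      have h1 : (-1 + 2 * (n : ℝ) / n) = 1 := by field_simp; norm_num
      have h2 := hre _ _ (hPC 1 (by norm_num) b hb ((e : ℝ) / n) (by norm_num))
      simp only [V, h1]
      show 0 < (u (P (1, (b : ℝ) / n, (e : ℝ) / n))).1.re
      rw [show P (1, (b : ℝ) / n, (e : ℝ) / n) = (1, (P (1, (b : ℝ) / n, (e : ℝ) / n)).2) from rfl, h2]
      linarith)
    (by
      intro b hb e he
      have h1 : (-1 + 2 * ((0 : ℕ) : ℝ) / n) = -1 := by simp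
      have h2 := hre _ _ (hPC (-1) (by norm_num) b hb ((e : ℝ) / n) (by norm_num))
      simp only [V, h1]
      show ¬ 0 < (u (P (-1, (b : ℝ) / n, (e : ℝ) / n))).1.re
      rw [show P (-1, (b : ℝ) / n, (e : ℝ) / n) = (-1, (P (-1, (b : ℝ) / n, (e : ℝ) / n)).2) from rfl, h2]
      linarith)
    ε
    (fun a ha e he => cTwo_eq (hε a ha e) (hε a ha (e + 1)) (hip1 a e))
    (fun a ha e he => cTwo_eq (hε a (by omega) e) (hε (a + 1) (by omega) e) (hip0 a (a + 1) e))
  have hell : ell n n = tauTwo (ell n 0) := by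
    simp only [ell, tauTwo, hjconj]
    simp [div_self hnpos.ne', Complex.exp_pi_mul_I]
  have hneq : ∀ x, 0 < ipTwo x x → x ≠ tauTwo x := by
    intro x hx h
    have h1 := ipTwo_tau_left x x
    rw [← h] at h1
    linarith
  rcases hε n le_rfl 0 with ⟨h1, h2⟩ | ⟨h1, h2⟩ <;>
    rcases hε n le_rfl n with ⟨h3, h4⟩ | ⟨h3, h4⟩
  · rw [hVP, h1, hell] at h3
    exact hneq _ (hip0 n n 0) h3
  · rw [h2, h4] at hfinal; exact absurd hfinal (by decide)
  · rw [h2, h4] at hfinal; exact absurd hfinal (by decide)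
  · rw [hVP, h1, ← hell] at h3
    exact hneq _ (hip0 n n n) h3

/-- The standard primitive cube root of unity. -/
def omg : ℂ := Complex.exp (2 * Real.pi * Complex.I / (3 : ℕ))

theorem omg_prim : IsPrimitiveRoot omg 3 := Complex.isPrimitiveRoot_exp 3 (by norm_num)

theorem omg_re : omg.re = -1 / 2 := by
  have h : omg = Complex.exp ((Real.pi - Real.pi / 3 : ℝ) * Complex.I) := by
    unfold omg
    congr 1
    push_cast
    ring
  rw [h, Complex.exp_ofReal_mul_I_re, Real.cos_pi_sub, Real.cos_pi_div_three]
  norm_num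

theorem omg_norm : ‖omg‖ = 1 := omg_prim.norm'_eq_one (by norm_num)

theorem omg_im : omg.im = √3 / 2 := by
  have h : omg = Complex.exp ((Real.pi - Real.pi / 3 : ℝ) * Complex.I) := by
    unfold omg
    congr 1
    push_cast
    ring
  rw [h, Complex.exp_ofReal_mul_I_im, Real.sin_pi_sub, Real.sin_pi_div_three]

theorem omg_pow_mod (k : ℕ) : omg ^ k = omg ^ (k % 3) := by
  conv_lhs => rw [← Nat.div_add_mod k 3, pow_add, pow_mul, omg_prim.pow_eq_one, one_pow, one_mul]

theorem omg_pow_three : omg ^ 3 = 1 := omg_prim.pow_eq_one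

theorem conj_omg : starRingEnd ℂ omg = omg ^ 2 := by
  have h : omg * starRingEnd ℂ omg = 1 := by
    rw [Complex.mul_conj, Complex.normSq_eq_norm_sq, omg_norm]; simp
  have h0 : omg ≠ 0 := omg_prim.ne_zero (by norm_num)
  apply mul_left_cancel₀ h0
  rw [h, ← pow_succ', omg_pow_three]

/-- Hermitian form. -/
def herm (p q : ℂ × ℂ) : ℂ := p.1 * starRingEnd ℂ q.1 + p.2 * starRingEnd ℂ q.2

def sct (y : ℂ) : Prop := 2 * |y.im| < y.re

theorem sct_omg {y : ℂ} (h : sct y) : ¬ sct (omg * y) := by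
  unfold sct at *
  intro h2
  have h3 : 0 < (omg * y).re := lt_of_le_of_lt (by positivity) h2
  rw [Complex.mul_re, omg_re] at h3
  have h4 : |omg.im * y.im| ≤ |y.im| := by
    rw [abs_mul]
    have : |omg.im| ≤ 1 := (Complex.abs_im_le_norm _).trans omg_norm.le
    nlinarith [abs_nonneg y.im]
  have := abs_le.mp h4
  linarith

theorem sct_omg_sq {y : ℂ} (h : sct y) : ¬ sct (omg ^ 2 * y) := by
  intro h2
  have := sct_omg h2
  rw [← mul_assoc, ← pow_succ', omg_pow_three, one_mul] at this
  exact this h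

def cph (y : ℂ) : ZMod 3 := if sct y then 0 else if sct (omg * y) then 1 else 2

theorem cph_eq {y : ℂ} (h : sct y) (k : ℕ) : cph (omg ^ k * y) = -(k : ZMod 3) := by
  have e1 := omg_pow_mod k
  have e2 : (k : ZMod 3) = ((k % 3 : ℕ) : ZMod 3) := by simp
  rw [e1, e2]
  have h3 : k % 3 < 3 := Nat.mod_lt _ (by norm_num)
  generalize k % 3 = a at h3
  have hb : omg * (omg * y) = omg ^ 2 * y := by ring
  have hc : omg * (omg ^ 2 * y) = y := by
    rw [← mul_assoc, ← pow_succ', omg_pow_three, one_mul]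
  interval_cases a
  · simp [cph, h]
  · simp only [pow_one, cph, sct_omg h, hb, sct_omg_sq h, if_false]; decide
  · simp only [cph, sct_omg_sq h, hc, h, if_false, if_true]; decide

def rotw (k : ℕ) (p : ℂ × ℂ) : ℂ × ℂ := (omg ^ k * p.1, omg ^ k * p.2)

def cThree (p q : ℂ × ℂ) : ZMod 3 := cph (herm p q)

theorem cThree_eq {x x' l l' : ℂ × ℂ} {k k' : ℕ} (h : x = rotw k l) (h' : x' = rotw k' l')
    (hp : sct (herm l l')) : cThree x x' = (k' : ZMod 3) - k := by
  have e : herm x x' = omg ^ (k + 2 * k') * herm l l' := by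
    subst h h'
    simp only [herm, rotw, map_mul, map_pow, conj_omg]
    ring
  rw [cThree, e, cph_eq hp]
  push_cast
  have : (2 : ZMod 3) = -1 := by decide
  rw [this]; ring

theorem herm_self (x : ℂ × ℂ) : herm x x = ((‖x.1‖ ^ 2 + ‖x.2‖ ^ 2 : ℝ) : ℂ) := by
  simp [herm, Complex.mul_conj, Complex.normSq_eq_norm_sq]

theorem sct_self {x : ℂ × ℂ} (hx : x ≠ 0) : sct (herm x x) := by
  rw [herm_self]
  unfold sct
  rw [Complex.ofReal_im, Complex.ofReal_re]
  have : 0 < ‖x.1‖ ^ 2 + ‖x.2‖ ^ 2 := by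
    by_contra h
    push Not at h
    apply hx
    have h1 : ‖x.1‖ = 0 := by nlinarith [sq_nonneg ‖x.1‖, sq_nonneg ‖x.2‖]
    have h2 : ‖x.2‖ = 0 := by nlinarith [sq_nonneg ‖x.1‖, sq_nonneg ‖x.2‖]
    ext1
    · exact norm_eq_zero.mp h1
    · exact norm_eq_zero.mp h2
  simpa using this

theorem cThree_self {x : ℂ × ℂ} (hx : x ≠ 0) : cThree x x = 0 := by
  rw [cThree, cph, if_pos (sct_self hx)]

theorem isOpen_sct : IsOpen {p : (ℂ × ℂ) × (ℂ × ℂ) | sct (herm p.1 p.2)} := by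
  unfold sct herm
  have h : Continuous fun p : (ℂ × ℂ) × (ℂ × ℂ) =>
      p.1.1 * starRingEnd ℂ p.2.1 + p.1.2 * starRingEnd ℂ p.2.2 := by
    have := Complex.continuous_conj
    fun_prop
  exact isOpen_lt (continuous_const.mul (Complex.continuous_im.comp h).abs)
    (Complex.continuous_re.comp h)

theorem no_chart_three {H : Type*} [NormedAddCommGroup H] [NormedSpace ℝ H]
    [FiniteDimensional ℝ H] (hH : Module.finrank ℝ H = 4) (Φ : ℂ × ℂ → H) (δ : ℝ) (hδ : 0 < δ)
    (hc : ContinuousOn Φ (Metric.ball 0 δ))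
    (ho : ∀ O ⊆ Metric.ball 0 δ, IsOpen O → IsOpen (Φ '' O)) (hΦ0 : Φ 0 = 0)
    (hfib : ∀ w ∈ Metric.ball (0 : ℂ × ℂ) δ, ∀ w' ∈ Metric.ball (0 : ℂ × ℂ) δ,
      (Φ w = Φ w' ↔ ∃ k : ℕ, w' = rotw k w)) : False := by
  set r : ℝ := δ / 2 with hrdef
  have hr : 0 < r := by positivity
  have hrδ : r < δ := by linarith
  have h0mem : (0 : ℂ × ℂ) ∈ Metric.ball 0 δ := Metric.mem_ball_self hδ
  have hmemb : ∀ b : ℂ, ‖b‖ ≤ r → ((0 : ℂ), b) ∈ Metric.ball (0 : ℂ × ℂ) δ := by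
    intro b hb
    rw [mem_ball_zero_iff, Prod.norm_def]
    exact max_lt (by simpa using hδ) (hb.trans_lt hrδ)
  let j : (Fin 0 → ℝ) → ℂ := fun _ => 0
  have hinv : ∀ s z z', ‖z‖ ≤ r → z ^ 3 = z' ^ 3 → Φ (j s, z) = Φ (j s, z') := by
    intro s z z' hz h
    have hz' : ‖z'‖ ≤ r := by
      have h1 : ‖z‖ ^ 3 = ‖z'‖ ^ 3 := by rw [← norm_pow, ← norm_pow, h]
      rw [← (pow_left_inj₀ (norm_nonneg _) (norm_nonneg _) three_ne_zero).mp h1]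
      exact hz
    refine (hfib _ (hmemb _ hz) _ (hmemb _ hz')).mpr ?_
    by_cases h0 : z = 0
    · subst h0
      have : z' = 0 := by
        rw [zero_pow (by norm_num)] at h
        exact pow_eq_zero_iff (by norm_num) |>.mp h.symm
      exact ⟨0, by simp [rotw, this]⟩
    · obtain ⟨k, -, hk⟩ := omg_prim.eq_pow_of_pow_eq_one (ξ := z' / z)
        (by rw [div_pow, ← h, div_self (pow_ne_zero _ h0)])
      refine ⟨k, ?_⟩
      simp only [rotw, hk, mul_zero]
      rw [div_mul_cancel₀ _ h0]
  let C : Set ((Fin 0 → ℝ) × ℂ) := Set.univ ×ˢ Metric.sphere (0 : ℂ) 1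
  have hCc : IsCompact C := isCompact_univ.prod (isCompact_sphere _ _)
  have hC : ∀ p ∈ C, j p.1 ≠ 0 ∨ p.2 ≠ 0 := by
    rintro ⟨s, w⟩ ⟨-, h3⟩
    right
    simp only at h3 ⊢
    rintro rfl
    simp at h3
  obtain ⟨φ', hφc, hφ0, hφm, hφC⟩ := exists_pushed_family (S := Fin 0 → ℝ) (H := H)
    (by rw [hH]; simp) three_ne_zero Φ δ r hr hrδ hc ho
    (by
      intro w hw h
      rw [← hΦ0] at h
      obtain ⟨k, hk⟩ := (hfib 0 h0mem w hw).mp h.symm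
      rw [hk]; simp [rotw])
    j continuous_const (fun s => by simpa [j] using hr.le) hinv C hCc hC
  choose u hub hu using hφm
  have hune : ∀ p, u p ≠ 0 := by
    intro p hp
    apply hφ0 p
    rw [← hu, hp, hΦ0]
  have hloc : ∀ p : (Fin 0 → ℝ) × ℂ, ∃ O : Set ((Fin 0 → ℝ) × ℂ), (IsOpen O ∧ p ∈ O) ∧
        ∃ ε : ℂ × ℂ → ZMod 3, ∀ q ∈ O, ∀ q' ∈ O, cThree (u q) (u q') = ε (u q') - ε (u q) := by
    intro p
    obtain ⟨N, hN, hpN, hNN⟩ := exists_pos_nhd (f := fun p => sct (herm p.1 p.2))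
        isOpen_sct (u p) (sct_self (hune p))
    refine ⟨φ' ⁻¹' (Φ '' (N ∩ Metric.ball 0 δ)),
      ⟨(ho _ Set.inter_subset_right (hN.inter Metric.isOpen_ball)).preimage hφc,
        u p, ⟨hpN, hub p⟩, hu p⟩, ?_⟩
    have h1 : ∀ x : ℂ × ℂ, ∃ k : ℕ, (∃ k' : ℕ, ∃ w ∈ N, x = rotw k' w) → ∃ w ∈ N, x = rotw k w := by
      intro x
      by_cases h : ∃ k' : ℕ, ∃ w ∈ N, x = rotw k' w
      · exact ⟨h.choose, fun _ => h.choose_spec⟩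
      · exact ⟨0, fun h' => absurd h' h⟩
    choose ε hε using h1
    have h2 : ∀ q ∈ φ' ⁻¹' (Φ '' (N ∩ Metric.ball 0 δ)), ∃ w ∈ N, u q = rotw (ε (u q)) w := by
      rintro q ⟨w, ⟨hw, hwb⟩, hwq⟩
      apply hε
      rw [← hu q] at hwq
      obtain ⟨k, hk⟩ := (hfib w hwb (u q) (hub q)).mp hwq
      exact ⟨k, w, hw, hk⟩
    refine ⟨fun x => (ε x : ZMod 3), ?_⟩
    intro q hq q' hq'
    obtain ⟨w, hw, hw2⟩ := h2 q hq
    obtain ⟨w', hw', hw2'⟩ := h2 q' hq'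
    exact cThree_eq hw2 hw2' (hNN w hw w' hw')
  choose O hO hOgood using hloc
  let P : ℝ × ℝ × ℝ → (Fin 0 → ℝ) × ℂ :=
    fun q => (0, (q.2.1 : ℂ) * Complex.exp (2 * Real.pi * q.2.2 * Complex.I))
  have hPc : Continuous P := by
    dsimp only [P]
    fun_prop
  obtain ⟨n, hn9, hgrid⟩ := exists_fine_grid (fun p => P ⁻¹' (O p))
    (fun p => (hO p).1.preimage hPc) (fun q => ⟨P q, (hO (P q)).2⟩)
  have hnpos : (0 : ℝ) < n := by exact_mod_cast (by omega : 0 < n)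
  have hn0 : (n : ℂ) ≠ 0 := by exact_mod_cast hnpos.ne'
  let V : ℕ → ℕ → ℂ × ℂ := fun b e => u (P (-1 + 2 * ((0 + 0 : ℕ) : ℝ) / n, (b : ℝ) / n, (e : ℝ) / n))
  have hexpn : ∀ x : ℝ, ‖Complex.exp (2 * Real.pi * x * Complex.I)‖ = 1 := by
    intro x
    have := Complex.norm_exp_ofReal_mul_I (2 * Real.pi * x)
    push_cast at this
    exact this
  let ell : ℕ → ℂ × ℂ := fun e =>
    (0, r * Complex.exp (((2 * Real.pi * ((e : ℝ) / n) / 3 : ℝ) : ℂ) * Complex.I))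
  have hVell : ∀ e, ∃ k : ℕ, V n e = rotw k (ell e) := by
    intro e
    set z : ℂ := Complex.exp (((2 * Real.pi * ((e : ℝ) / n) / 3 : ℝ) : ℂ) * Complex.I) with hz
    have hz1 : ‖z‖ = 1 := by rw [hz, Complex.norm_exp_ofReal_mul_I]
    have hz3 : P (-1 + 2 * ((0 + 0 : ℕ) : ℝ) / n, (n : ℝ) / n, (e : ℝ) / n) = (0, z ^ 3) := by
      simp only [P, div_self hnpos.ne', Complex.ofReal_one, one_mul]
      rw [hz, ← Complex.exp_nat_mul]
      congr 2
      push_cast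
      ring
    have h1 := hφC 0 z hz1.le ⟨trivial, by simp [hz1]⟩
    rw [← hu] at h1
    obtain ⟨k, hk⟩ := (hfib _ (hmemb _ (by
      rw [norm_mul, Complex.norm_real, Real.norm_of_nonneg hr.le, hz1, mul_one])) _ (hub _)).mp h1.symm
    refine ⟨k, ?_⟩
    simp only [V]
    rw [hz3, hk]
  choose κ hκ using hVell
  have hsc : ∀ e, sct (herm (ell e) (ell (e + 1))) := by
    intro e
    have h1 : herm (ell e) (ell (e + 1)) =
        ((r ^ 2 : ℝ) : ℂ) * Complex.exp (((-(2 * Real.pi / (3 * n)) : ℝ) : ℂ) * Complex.I) := by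
      simp only [herm, ell, map_mul, Complex.conj_ofReal, ← Complex.exp_conj, Complex.conj_I]
      rw [zero_mul, zero_add, mul_mul_mul_comm, ← Complex.exp_add]
      congr 1
      · push_cast; ring
      · congr 1; push_cast; field_simp; ring
    rw [h1]
    unfold sct
    rw [Complex.re_ofReal_mul, Complex.im_ofReal_mul, Complex.exp_ofReal_mul_I_re,
      Complex.exp_ofReal_mul_I_im, abs_mul, abs_of_pos (by positivity : 0 < r ^ 2), Real.cos_neg,
      Real.sin_neg, abs_neg]
    set a := 2 * Real.pi / (3 * n) with ha
    have ha0 : 0 < a := by positivity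
    have ha1 : a < 1 / 4 := by
      rw [ha, div_lt_iff₀ (by positivity)]
      have h9 : (9 : ℝ) ≤ n := by exact_mod_cast hn9
      have := Real.pi_lt_d2
      linarith
    have hs : |Real.sin a| ≤ a := by
      have := Real.abs_sin_le_abs (x := a)
      rwa [abs_of_pos ha0] at this
    have hcs := Real.one_sub_sq_div_two_le_cos (x := a)
    have : 2 * |Real.sin a| < Real.cos a := by nlinarith
    nlinarith [sq_pos_of_pos hr]
  have hVP : ∀ b, V b n = V b 0 := by
    intro b
    simp only [V, P]
    congr 3
    simp [div_self hnpos.ne', Complex.exp_two_pi_mul_I]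
  have hsum := grid_two n V cThree (fun b => hVP b) (by
      intro e
      simp [V, P])
    (fun b e => cThree_self (hune _))
    (by
      intro b hb e he
      obtain ⟨p, hp⟩ := hgrid 0 (by omega) b hb e he
      obtain ⟨ε, hε⟩ := hOgood p
      have g : ∀ y ≤ 1, ∀ z ≤ 1, P (-1 + 2 * ((0 + 0 : ℕ) : ℝ) / n, ((b + y : ℕ) : ℝ) / n,
        ((e + z : ℕ) : ℝ) / n) ∈ O p := fun y hy z hz => hp 0 (by omega) y hy z hz
      have g' : ∀ y ≤ 1, ∀ z ≤ 1, ∀ y' ≤ 1, ∀ z' ≤ 1, cThree (V (b + y) (e + z)) (V (b + y') (e + z'))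
        = ε (V (b + y') (e + z')) - ε (V (b + y) (e + z)) := fun y hy z hz y' hy' z' hz' =>
          hε _ (g y hy z hz) _ (g y' hy' z' hz')
      have a1 := g' 0 (by omega) 0 (by omega) 1 le_rfl 0 (by omega)
      have a2 := g' 1 (by omega) 0 (by omega) 1 le_rfl 1 (by omega)
      have a3 := g' 0 (by omega) 0 (by omega) 0 (by omega) 1 (by omega)
      have a4 := g' 0 (by omega) 1 (by omega) 1 le_rfl 1 (by omega)
      simp only [add_zero] at a1 a2 a3 a4
      rw [a1, a2, a3, a4]
      ring)
  have hsum2 : ∑ e ∈ Finset.range n, cThree (V n e) (V n (e + 1)) = (κ n : ZMod 3) - κ 0 := by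
    rw [← Finset.sum_range_sub (fun e => (κ e : ZMod 3)) n]
    exact Finset.sum_congr rfl fun e _ => cThree_eq (hκ e) (hκ (e + 1)) (hsc e)
  rw [hsum] at hsum2
  have hmod : κ n % 3 = κ 0 % 3 := by
    have h := (sub_eq_zero.mp hsum2.symm)
    exact (ZMod.natCast_eq_natCast_iff' _ _ _).mp h
  have hpow : omg ^ κ n = omg ^ κ 0 := by
    rw [omg_pow_mod, hmod, ← omg_pow_mod]
  have h1 := hVP n
  rw [hκ n, hκ 0] at h1
  have h2 := congrArg Prod.snd h1
  simp only [rotw, hpow] at h2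
  have hk0 : omg ^ κ 0 ≠ 0 := pow_ne_zero _ (omg_prim.ne_zero (by norm_num))
  have h3 := mul_left_cancel₀ hk0 h2
  simp only [ell] at h3
  have hrc : (r : ℂ) ≠ 0 := by exact_mod_cast hr.ne'
  have h4 := mul_left_cancel₀ hrc h3
  have h5 : omg = 1 := by
    calc omg = Complex.exp (((2 * Real.pi * ((n : ℝ) / n) / 3 : ℝ) : ℂ) * Complex.I) := by
          unfold omg
          congr 1
          push_cast
          field_simp
      _ = 1 := by rw [h4]; simp
  exact omg_prim.ne_one (by norm_num) h5

theorem chart_reduce {X : Type*} [TopologicalSpace X] (Ψ : ℂ × ℂ → X) (δ : ℝ) (hδ : 0 < δ)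
    (hc : ContinuousOn Ψ (Metric.ball 0 δ))
    (ho : ∀ O ⊆ Metric.ball 0 δ, IsOpen O → IsOpen (Ψ '' O))
    (U : Set X) (hU : IsOpen U) (h0 : Ψ 0 ∈ U) (χ : ↥U ≃ₜ EuclideanSpace ℝ (Fin 4)) :
    ∃ δ' ≤ δ, 0 < δ' ∧ ∃ Φ : ℂ × ℂ → EuclideanSpace ℝ (Fin 4),
      ContinuousOn Φ (Metric.ball 0 δ') ∧
      (∀ O ⊆ Metric.ball 0 δ', IsOpen O → IsOpen (Φ '' O)) ∧ Φ 0 = 0 ∧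
      ∀ w ∈ Metric.ball (0 : ℂ × ℂ) δ', ∀ w' ∈ Metric.ball (0 : ℂ × ℂ) δ',
        (Φ w = Φ w' ↔ Ψ w = Ψ w') := by
  have h1 : IsOpen (Metric.ball 0 δ ∩ Ψ ⁻¹' U) := hc.isOpen_inter_preimage Metric.isOpen_ball hU
  obtain ⟨δ', hδ', hsub⟩ := Metric.isOpen_iff.mp h1 0 ⟨Metric.mem_ball_self hδ, h0⟩
  let δ2 := min δ δ'
  have hsub2 : ∀ w ∈ Metric.ball (0 : ℂ × ℂ) δ2, Ψ w ∈ U := fun w hw =>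
    (hsub (Metric.ball_subset_ball (min_le_right _ _) hw)).2
  let Φ : ℂ × ℂ → EuclideanSpace ℝ (Fin 4) := fun w =>
    if h : Ψ w ∈ U then χ ⟨Ψ w, h⟩ - χ ⟨Ψ 0, h0⟩ else 0
  have hΦ : ∀ w (h : Ψ w ∈ U), Φ w = χ ⟨Ψ w, h⟩ - χ ⟨Ψ 0, h0⟩ := fun w h => dif_pos h
  refine ⟨δ2, min_le_left _ _, lt_min hδ hδ', Φ, ?_, ?_, ?_, ?_⟩
  · rw [continuousOn_iff_continuous_domRestrict]
    have hcc : Continuous (fun w : Metric.ball (0 : ℂ × ℂ) δ2 => (⟨Ψ w, hsub2 w w.2⟩ : U)) := by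
      apply Continuous.subtype_mk
      exact continuousOn_iff_continuous_domRestrict.mp
        (hc.mono (Metric.ball_subset_ball (min_le_left _ _)))
    have : Set.domRestrict (Metric.ball (0 : ℂ × ℂ) δ2) Φ =
        fun w : Metric.ball (0 : ℂ × ℂ) δ2 => χ ⟨Ψ w, hsub2 w w.2⟩ - χ ⟨Ψ 0, h0⟩ := by
      funext w
      exact hΦ _ _
    rw [this]
    exact (χ.continuous.comp hcc).sub continuous_const
  · intro O hO hOo
    have h2 : IsOpen (Ψ '' O) := ho O (hO.trans (Metric.ball_subset_ball (min_le_left _ _))) hOo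
    have h3 : IsOpen ((fun y => y - χ ⟨Ψ 0, h0⟩) '' (χ '' (Subtype.val ⁻¹' (Ψ '' O)))) :=
      (Homeomorph.subRight _).isOpenMap _ (χ.isOpenMap _ (h2.preimage continuous_subtype_val))
    convert h3 using 1
    ext y
    constructor
    · rintro ⟨w, hw, rfl⟩
      exact ⟨_, ⟨⟨Ψ w, hsub2 w (hO hw)⟩, ⟨w, hw, rfl⟩, rfl⟩, (hΦ _ _).symm⟩
    · rintro ⟨_, ⟨⟨x, hx⟩, ⟨w, hw, hwx⟩, rfl⟩, rfl⟩
      simp only at hwx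
      subst hwx
      exact ⟨w, hw, hΦ _ _⟩
  · rw [hΦ 0 h0, sub_self]
  · intro w hw w' hw'
    rw [hΦ _ (hsub2 w hw), hΦ _ (hsub2 w' hw'), sub_left_inj, χ.injective.eq_iff, Subtype.mk.injEq]

theorem euclid_of_inj {X : Type*} [TopologicalSpace X] (Ψ : ℂ × ℂ → X) (δ : ℝ) (hδ : 0 < δ)
    (hc : ContinuousOn Ψ (Metric.ball 0 δ))
    (ho : ∀ O ⊆ Metric.ball 0 δ, IsOpen O → IsOpen (Ψ '' O))
    (hinj : Set.InjOn Ψ (Metric.ball 0 δ)) :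
    ∃ U : Set X, IsOpen U ∧ Ψ 0 ∈ U ∧ Nonempty (↥U ≃ₜ EuclideanSpace ℝ (Fin 4)) := by
  have hfr : Module.finrank ℝ (EuclideanSpace ℝ (Fin 4)) = Module.finrank ℝ (ℂ × ℂ) := by
    simp [Complex.finrank_real_complex]
  let L : EuclideanSpace ℝ (Fin 4) ≃L[ℝ] ℂ × ℂ := ContinuousLinearEquiv.ofFinrankEq hfr
  let B := OpenPartialHomeomorph.univBall (0 : ℂ × ℂ) δ
  have hBs : B.source = Set.univ := OpenPartialHomeomorph.univBall_source _ _
  have hBt : B.target = Metric.ball 0 δ := OpenPartialHomeomorph.univBall_target _ hδ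
  have hB0 : B 0 = 0 := OpenPartialHomeomorph.univBall_apply_zero _ _
  have hBm : ∀ x, B x ∈ Metric.ball (0 : ℂ × ℂ) δ := fun x => by
    rw [← hBt]; exact B.map_source (by rw [hBs]; trivial)
  have hBo : Topology.IsOpenEmbedding B := B.isOpenEmbedding hBs
  have hemb : Topology.IsOpenEmbedding (fun x => Ψ (B (L x))) := by
    refine .of_continuous_injective_isOpenMap ?_ ?_ ?_
    · exact hc.comp_continuous (hBo.continuous.comp L.continuous) (fun x => hBm _)
    · intro x y h
      exact L.injective (hBo.injective (hinj (hBm _) (hBm _) h))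
    · intro O hO
      have := ho (B '' (L '' O)) (by rintro _ ⟨x, -, rfl⟩; exact hBm x)
        (hBo.isOpenMap _ (L.toHomeomorph.isOpenMap _ hO))
      rw [Set.image_image, Set.image_image] at this
      exact this
  refine ⟨_, hemb.isOpen_range, ⟨0, ?_⟩, ⟨hemb.toIsEmbedding.toHomeomorph.symm⟩⟩
  simp [hB0]

/-- Flags: a simplex with a complete ordering of its vertices. -/
abbrev Flg (D : GlueingDatum 4) : Type := D.I × Equiv.Perm (Fin 5)

abbrev swp : Equiv.Perm (Fin 5) := Equiv.swap 3 4

theorem swp_mul_self : swp * swp = 1 := Equiv.swap_mul_self 3 4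

/-- Relabelling a flag. -/
def Rmul {D : GlueingDatum 4} (g : Equiv.Perm (Fin 5)) (f : Flg D) : Flg D := (f.1, f.2 * g)

/-- Crossing a face. -/
def crs (D : GlueingDatum 4) (v : Fin 5) (f : Flg D) : Flg D :=
  ((D.P (f.1, f.2 v)).1, D.glue (f.1, f.2 v) * f.2 * swp)

theorem crs_crs (D : GlueingDatum 4) (v v' : Fin 5) (hv : swp v' = v) (f : Flg D) :
    crs D v' (crs D v f) = f := by
  obtain ⟨i, e⟩ := f
  have h1 : (crs D v (i, e)).2 v' = (D.P (i, e v)).2 := by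
    simp only [crs, Equiv.Perm.mul_apply, hv]
    exact D.glue_face (i, e v)
  have h2 : ((crs D v (i, e)).1, (crs D v (i, e)).2 v') = D.P (i, e v) := by
    rw [h1]; rfl
  have h3 : crs D v' (crs D v (i, e)) = ((D.P (D.P (i, e v))).1,
      D.glue (D.P (i, e v)) * (D.glue (i, e v) * e * swp) * swp) := by
    rw [← h2]; rfl
  rw [h3, D.P_involutive, D.glue_symm]
  ext1
  · rfl
  · show (D.glue (i, e v))⁻¹ * (D.glue (i, e v) * e * swp) * swp = e
    rw [mul_assoc, mul_assoc, mul_assoc, swp_mul_self, mul_one, inv_mul_cancel_left]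

/-- Rotation around a triangle. -/
def rtn (D : GlueingDatum 4) : Equiv.Perm (Flg D) where
  toFun := crs D 3
  invFun := crs D 4
  left_inv := crs_crs D 3 4 (by decide)
  right_inv := crs_crs D 4 3 (by decide)

def fix34 (g : Equiv.Perm (Fin 5)) : Prop := g 3 = 3 ∧ g 4 = 4

theorem fix34.swp_comm {g : Equiv.Perm (Fin 5)} (hg : fix34 g) : g * swp = swp * g := by
  have h := Equiv.swap_mul_eq_mul_swap g 3 4
  have h3 : g⁻¹ 3 = 3 := by rw [Equiv.Perm.inv_eq_iff_eq, hg.1]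
  have h4 : g⁻¹ 4 = 4 := by rw [Equiv.Perm.inv_eq_iff_eq, hg.2]
  rw [h3, h4] at h
  exact h.symm

theorem rtn_Rmul (D : GlueingDatum 4) {g : Equiv.Perm (Fin 5)} (hg : fix34 g) (f : Flg D) :
    rtn D (Rmul g f) = Rmul g (rtn D f) := by
  show crs D 3 (Rmul g f) = Rmul g (crs D 3 f)
  simp only [crs, Rmul, Equiv.Perm.mul_apply, hg.1]
  ext1
  · rfl
  · show D.glue (f.1, f.2 3) * (f.2 * g) * swp = D.glue (f.1, f.2 3) * f.2 * swp * g
    simp only [mul_assoc, hg.swp_comm]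

theorem Rmul_Rmul {D : GlueingDatum 4} (g h : Equiv.Perm (Fin 5)) (f : Flg D) :
    Rmul h (Rmul g f) = Rmul (g * h) f := by
  simp [Rmul, mul_assoc]

theorem Rmul_one {D : GlueingDatum 4} (f : Flg D) : Rmul 1 f = f := by
  simp [Rmul]

theorem Rmul_inj {D : GlueingDatum 4} {g h : Equiv.Perm (Fin 5)} {f : Flg D}
    (H : Rmul g f = Rmul h f) : g = h := by
  have := congrArg Prod.snd H
  exact mul_left_cancel this

theorem rtn_zpow_Rmul (D : GlueingDatum 4) {g : Equiv.Perm (Fin 5)} (hg : fix34 g) (q : ℤ) :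
    ∀ f : Flg D, (rtn D ^ q) (Rmul g f) = Rmul g ((rtn D ^ q) f) := by
  have h1 : ∀ n : ℕ, ∀ f : Flg D, (rtn D ^ n) (Rmul g f) = Rmul g ((rtn D ^ n) f) := by
    intro n
    induction n with
    | zero => intro f; rfl
    | succ n ih =>
      intro f
      rw [pow_succ', Equiv.Perm.mul_apply, ih, rtn_Rmul D hg, ← Equiv.Perm.mul_apply]
  intro f
  obtain ⟨n, rfl | rfl⟩ := q.eq_nat_or_neg
  · rw [zpow_natCast]; exact h1 n f
  · rw [zpow_neg, zpow_natCast, Equiv.Perm.inv_eq_iff_eq, h1]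
    simp

instance (D : GlueingDatum 4) : Finite (Flg D) := by
  have := D.fintypeI
  infer_instance

theorem exists_period (D : GlueingDatum 4) (f : Flg D) :
    ∃ N : ℕ, 0 < N ∧ ∀ q : ℤ, (rtn D ^ q) f = f ↔ (N : ℤ) ∣ q := by
  refine ⟨Function.minimalPeriod (fun x => rtn D • x) f, ?_, ?_⟩
  · exact Nat.pos_of_ne_zero (MulAction.minimalPeriod_pos (rtn D) f).out
  · intro q
    exact MulAction.zpow_smul_eq_iff_minimalPeriod_dvd (a := rtn D) (b := f) (n := q)

theorem rtn_excl_nat (D : GlueingDatum 4) {g : Equiv.Perm (Fin 5)} (hg : fix34 g) (q : ℕ) :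
    ∀ f : Flg D, (rtn D ^ q) f ≠ Rmul (swp * g) f := by
  induction q using Nat.strong_induction_on with
  | _ q ih =>
    intro f h
    match q, ih, h with
    | 0, ih, h =>
      have h1 := congrArg Prod.snd h
      have h2 : f.2 = f.2 * (swp * g) := h1
      have h3 := (mul_eq_left.mp h2.symm)
      have h4 := congrArg (fun p : Equiv.Perm (Fin 5) => p 3) h3
      simp [Equiv.Perm.mul_apply, hg.1] at h4
    | 1, ih, h =>
      rw [pow_one] at h
      have h1 : (D.P (f.1, f.2 3)).1 = f.1 := congrArg Prod.fst h
      have h2 : D.glue (f.1, f.2 3) * f.2 * swp = f.2 * (swp * g) := congrArg Prod.snd h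
      have h3 := congrArg (fun p : Equiv.Perm (Fin 5) => p 4) h2
      have h4 := D.glue_face (f.1, f.2 3)
      simp only [Equiv.Perm.mul_apply, hg.2] at h3
      rw [show swp 4 = 3 by decide] at h3
      rw [h3] at h4
      exact D.P_fixedPointFree (f.1, f.2 3) (Prod.ext h1 h4.symm)
    | q + 2, ih, h =>
      refine ih q (by omega) (rtn D f) ?_
      have h1 : (rtn D ^ (q + 1)) f = crs D 4 (Rmul (swp * g) f) := by
        rw [← h]
        have : rtn D ^ (q + 2) = rtn D * rtn D ^ (q + 1) := by rw [← pow_succ']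
        rw [this, Equiv.Perm.mul_apply]
        exact ((rtn D).symm_apply_apply _).symm
      have h2 : (rtn D ^ q) (rtn D f) = (rtn D ^ (q + 1)) f := by
        rw [pow_succ, Equiv.Perm.mul_apply]
      rw [h2, h1]
      show crs D 4 (Rmul (swp * g) f) = Rmul (swp * g) (crs D 3 f)
      have h5 : (Rmul (swp * g) f).2 4 = f.2 3 := by
        simp only [Rmul, Equiv.Perm.mul_apply, hg.2]
        rw [show swp 4 = 3 by decide]
      have h6 : (Rmul (swp * g) f).1 = f.1 := rfl
      unfold crs
      rw [h5, h6]
      ext1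
      · rfl
      · simp only [Rmul, mul_assoc, hg.swp_comm]

theorem rtn_excl (D : GlueingDatum 4) {g : Equiv.Perm (Fin 5)} (hg : fix34 g) (q : ℤ) (f : Flg D) :
    (rtn D ^ q) f ≠ Rmul (swp * g) f := by
  obtain ⟨N, hN, hNq⟩ := exists_period D f
  have h1 : 0 ≤ q + N * |q| := by
    have : (1 : ℤ) ≤ N := by exact_mod_cast hN
    nlinarith [abs_nonneg q, neg_abs_le q]
  obtain ⟨n, hn⟩ := Int.eq_ofNat_of_zero_le h1
  have h2 : (rtn D ^ q) f = (rtn D ^ n) f := by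
    rw [← zpow_natCast, ← hn, zpow_add, Equiv.Perm.mul_apply, (hNq _).mpr (dvd_mul_right _ _)]
  rw [h2]
  exact rtn_excl_nat D hg n f

theorem glueRel_symm {D : GlueingDatum 4} {p q : GlueTotal D} (h : glueRel D p q) :
    glueRel D q p := by
  obtain ⟨i, x⟩ := p
  obtain ⟨j, y⟩ := q
  obtain ⟨k, h1, h2, h3⟩ := h
  simp only at h1 h2 h3
  subst h2
  have h4 : D.P ((D.P (i, k)).1, (D.P (i, k)).2) = (i, k) := D.P_involutive (i, k)
  have h5 : D.glue ((D.P (i, k)).1, (D.P (i, k)).2) = (D.glue (i, k)).symm := D.glue_symm (i, k)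
  refine ⟨(D.P (i, k)).2, ?_, ?_, ?_⟩
  · simp only [h3, Function.comp]
    have := D.glue_face (i, k)
    rw [← this]
    simpa using h1
  · simp only
    rw [h4]
  · simp only
    rw [h5, h3]
    funext v
    simp

/-- Permuting barycentric coordinates. -/
def pm (g : Equiv.Perm (Fin 5)) (x : Delta 4) : Delta 4 :=
  ⟨x.1 ∘ g, fun v => x.2.1 (g v), 
    (Equiv.sum_comp g x.1).trans x.2.2⟩

theorem continuous_pm (g : Equiv.Perm (Fin 5)) : Continuous (pm g) := by
  unfold pm
  apply Continuous.subtype_mk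
  exact continuous_pi fun a => (continuous_apply (g a)).comp continuous_subtype_val

def cc (x : Fin 5 → ℝ) : ℂ := x 0 + omg * x 1 + omg ^ 2 * x 2

theorem cc_re (x : Fin 5 → ℝ) : (cc x).re = x 0 - (x 1 + x 2) / 2 := by
  simp only [cc, ← conj_omg]
  simp [omg_re]
  ring

theorem cc_im (x : Fin 5 → ℝ) : (cc x).im = √3 / 2 * (x 1 - x 2) := by
  simp only [cc, ← conj_omg]
  simp [omg_im]
  ring

theorem cc_eq_iff (x y : Fin 5 → ℝ) :
    cc x = cc y ↔ x 0 - x 1 = y 0 - y 1 ∧ x 1 - x 2 = y 1 - y 2 := by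
  have h3 : √3 / 2 ≠ 0 := by positivity
  rw [Complex.ext_iff, cc_re, cc_re, cc_im, cc_im, mul_right_inj' h3]
  constructor
  · rintro ⟨h1, h2⟩; constructor <;> linarith
  · rintro ⟨h1, h2⟩; constructor <;> linarith

theorem fix34.lt {g : Equiv.Perm (Fin 5)} (hg : fix34 g) (a : Fin 5) (ha : a < 3) : g a < 3 := by
  have h1 : g a ≠ 3 := fun h => by
    rw [← hg.1] at h
    have := g.injective h
    omega
  have h2 : g a ≠ 4 := fun h => by
    rw [← hg.2] at h
    have := g.injective h
    omega
  omega

theorem cc_perm {g : Equiv.Perm (Fin 5)} (hg : fix34 g) {x y : Fin 5 → ℝ} (h : cc x = cc y) :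
    cc (x ∘ g) = cc (y ∘ g) := by
  rw [cc_eq_iff] at h ⊢
  have h1 : ∀ a : Fin 5, a < 3 → x a - y a = x 0 - y 0 := by
    intro a ha
    have : a = 0 ∨ a = 1 ∨ a = 2 := by omega
    rcases this with rfl | rfl | rfl <;> linarith
  have h20 := h1 (g 0) (hg.lt 0 (by decide))
  have h21 := h1 (g 1) (hg.lt 1 (by decide))
  have h22 := h1 (g 2) (hg.lt 2 (by decide))
  simp only [Function.comp]
  constructor <;> linarith

def ang (N : ℕ) (t : ℝ) : ℂ := Complex.exp (((2 * Real.pi * t / N : ℝ) : ℂ) * Complex.I)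

theorem norm_ang (N : ℕ) (t : ℝ) : ‖ang N t‖ = 1 := Complex.norm_exp_ofReal_mul_I _

theorem ang_add (N : ℕ) (t u : ℝ) : ang N (t + u) = ang N t * ang N u := by
  unfold ang
  rw [← Complex.exp_add]
  congr 1
  push_cast
  ring

theorem ang_eq_iff {N : ℕ} (hN : 0 < N) (t u : ℝ) : ang N t = ang N u ↔ ∃ m : ℤ, t = u + N * m := by
  have hN' : (N : ℂ) ≠ 0 := by exact_mod_cast hN.ne'
  have hpi : (Real.pi : ℂ) ≠ 0 := by exact_mod_cast Real.pi_ne_zero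
  unfold ang
  rw [Complex.exp_eq_exp_iff_exists_int]
  apply exists_congr
  intro m
  rw [← Complex.ofReal_inj]
  push_cast
  constructor
  · intro h
    field_simp at h
    have := Complex.I_ne_zero
    linear_combination h
  · intro h
    field_simp
    linear_combination h

def dd (N : ℕ) (r : ℤ) (x : Fin 5 → ℝ) : ℂ × ℂ :=
  (cc x, ((x 3 + x 4 : ℝ) : ℂ) * ang N (r + x 4 / (x 3 + x 4)))

theorem dd_swp (N : ℕ) (r : ℤ) (x : Fin 5 → ℝ) (hx : x 3 = 0) :
    dd N (r + 1) (x ∘ swp) = dd N r x := by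
  have e0 : swp 0 = 0 := by decide
  have e1 : swp 1 = 1 := by decide
  have e2 : swp 2 = 2 := by decide
  have e3 : swp 3 = 4 := by decide
  have e4 : swp 4 = 3 := by decide
  simp only [dd, cc, Function.comp, e0, e1, e2, e3, e4, hx, add_zero, zero_add, zero_div]
  by_cases h : x 4 = 0
  · simp [h]
  · rw [div_self h]; push_cast; rfl

theorem dd_period {N : ℕ} (hN : 0 < N) (r m : ℤ) (x : Fin 5 → ℝ) :
    dd N (r + N * m) x = dd N r x := by
  simp only [dd]
  congr 2
  rw [ang_eq_iff hN]
  exact ⟨m, by push_cast; ring⟩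

theorem continuous_dd (N : ℕ) (r : ℤ) : Continuous (fun x : Delta 4 => dd N r x.1) := by
  have hcv : ∀ a : Fin 5, Continuous (fun x : Delta 4 => x.1 a) := fun a =>
    (continuous_apply a).comp continuous_subtype_val
  have h3 := hcv 3
  have h4 := hcv 4
  have hs : Continuous (fun x : Delta 4 => x.1 3 + x.1 4) := h3.add h4
  refine Continuous.prodMk ?_ ?_
  · unfold cc
    have h0 := hcv 0
    have h1 := hcv 1
    have h2 := hcv 2
    exact ((Complex.continuous_ofReal.comp h0).add
      (continuous_const.mul (Complex.continuous_ofReal.comp h1))).add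
      (continuous_const.mul (Complex.continuous_ofReal.comp h2))
  · rw [continuous_iff_continuousAt]
    intro x
    by_cases h : x.1 3 + x.1 4 = 0
    · have h5 : Filter.Tendsto (fun y : Delta 4 => (((y.1 3 + y.1 4 : ℝ) : ℂ)
          * ang N (r + y.1 4 / (y.1 3 + y.1 4)))) (nhds x) (nhds 0) := by
        rw [tendsto_zero_iff_norm_tendsto_zero]
        have h6 := (hs.norm).tendsto x
        rw [h, norm_zero] at h6
        refine h6.congr ?_
        intro y
        rw [norm_mul, norm_ang, mul_one, Complex.norm_real]
      have h7 : (((x.1 3 + x.1 4 : ℝ) : ℂ) * ang N (r + x.1 4 / (x.1 3 + x.1 4))) = 0 := by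
        rw [h]; simp
      rw [← h7] at h5
      exact h5
    · have h5 : ContinuousAt (fun y : Delta 4 => y.1 4 / (y.1 3 + y.1 4)) x :=
        h4.continuousAt.div hs.continuousAt h
      have h6 : Continuous (fun p : ℝ × ℝ => ((p.1 : ℝ) : ℂ) * ang N (r + p.2)) := by
        unfold ang
        fun_prop
      exact h6.continuousAt.comp (hs.continuousAt.prodMk h5)

theorem norm_dd_snd (N : ℕ) (r : ℤ) (x : Delta 4) : ‖(dd N r x.1).2‖ = x.1 3 + x.1 4 := by
  simp only [dd, norm_mul, norm_ang, mul_one, Complex.norm_real]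
  exact Real.norm_of_nonneg (add_nonneg (x.2.1 3) (x.2.1 4))

theorem delta_sum (x : Delta 4) : x.1 0 + x.1 1 + x.1 2 + x.1 3 + x.1 4 = 1 := by
  have := x.2.2
  rwa [Fin.sum_univ_five] at this

theorem rep_big {N : ℕ} {r : ℤ} {x : Delta 4}
    (h : dd N r x.1 ∈ Metric.ball (0 : ℂ × ℂ) (1 / 20)) :
    1 / 4 < x.1 0 ∧ 1 / 4 < x.1 1 ∧ 1 / 4 < x.1 2 := by
  rw [mem_ball_zero_iff, Prod.norm_def, max_lt_iff, norm_dd_snd] at h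
  obtain ⟨h1, h2⟩ := h
  have h3 := delta_sum x
  have hre := abs_le.mp (Complex.abs_re_le_norm (dd N r x.1).1)
  have him := abs_le.mp (Complex.abs_im_le_norm (dd N r x.1).1)
  rw [show (dd N r x.1).1 = cc x.1 from rfl] at hre him h1
  rw [cc_re] at hre
  rw [cc_im] at him
  have hq : 1 ≤ √3 := by rw [Real.one_le_sqrt]; norm_num
  have h4 : -(1 / 10) < x.1 1 - x.1 2 := by
    by_contra hc
    nlinarith
  have h5 : x.1 1 - x.1 2 < 1 / 10 := by
    by_contra hc
    nlinarith
  refine ⟨?_, ?_, ?_⟩ <;> linarith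

theorem exists_rep {N : ℕ} (hN : 0 < N) (w : ℂ × ℂ) (hw : w ∈ Metric.ball (0 : ℂ × ℂ) (1 / 20)) :
    ∃ (r : ℤ) (x : Delta 4), dd N r x.1 = w := by
  obtain ⟨c, z⟩ := w
  rw [mem_ball_zero_iff, Prod.norm_def, max_lt_iff] at hw
  simp only at hw
  obtain ⟨hc, hz⟩ := hw
  have hre := abs_le.mp (Complex.abs_re_le_norm c)
  have him := abs_le.mp (Complex.abs_im_le_norm c)
  have hq : 1 ≤ √3 := by rw [Real.one_le_sqrt]; norm_num
  have hz0 := norm_nonneg z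
  set t : ℝ := N * z.arg / (2 * Real.pi) with ht
  have hN' : (N : ℝ) ≠ 0 := by exact_mod_cast hN.ne'
  have ha0 := Int.fract_nonneg t
  have ha1 := (Int.fract_lt_one t).le
  set k : ℝ := c.im / √3 with hk
  have hk1 : |k| ≤ 1 / 20 := by
    rw [hk, abs_div, abs_of_pos (by positivity : 0 < √3)]
    rw [div_le_iff₀ (by positivity)]
    have := Complex.abs_im_le_norm c
    nlinarith
  have hk2 := abs_le.mp hk1
  let x : Fin 5 → ℝ := ![(1 - ‖z‖ + 2 * c.re) / 3, (1 - ‖z‖ - c.re) / 3 + k, (1 - ‖z‖ - c.re) / 3 - k,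
    ‖z‖ * (1 - Int.fract t), ‖z‖ * Int.fract t]
  have x0 : x 0 = (1 - ‖z‖ + 2 * c.re) / 3 := rfl
  have x1 : x 1 = (1 - ‖z‖ - c.re) / 3 + k := rfl
  have x2 : x 2 = (1 - ‖z‖ - c.re) / 3 - k := rfl
  have x3 : x 3 = ‖z‖ * (1 - Int.fract t) := rfl
  have x4 : x 4 = ‖z‖ * Int.fract t := rfl
  refine ⟨⌊t⌋, ⟨x, ?_, ?_⟩, ?_⟩
  · intro v
    have : ∀ v : Fin 5, v = 0 ∨ v = 1 ∨ v = 2 ∨ v = 3 ∨ v = 4 := by decide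
    have := this v
    rcases this with rfl | rfl | rfl | rfl | rfl
    · rw [x0]; linarith
    · rw [x1]; linarith
    · rw [x2]; linarith
    · rw [x3]; exact mul_nonneg hz0 (by linarith)
    · rw [x4]; exact mul_nonneg hz0 ha0
  · rw [Fin.sum_univ_five, x0, x1, x2, x3, x4]; ring
  · ext1
    · apply Complex.ext
      · show (cc x).re = c.re
        rw [cc_re, x0, x1, x2]; ring
      · show (cc x).im = c.im
        rw [cc_im, x1, x2, hk]; field_simp; ring
    · show ((x 3 + x 4 : ℝ) : ℂ) * ang N (⌊t⌋ + x 4 / (x 3 + x 4)) = z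
      have hs : x 3 + x 4 = ‖z‖ := by rw [x3, x4]; ring
      rw [hs, x4]
      by_cases h0 : z = 0
      · simp [h0]
      · have hn : ‖z‖ ≠ 0 := by simpa using h0
        rw [mul_div_cancel_left₀ _ hn, Int.floor_add_fract]
        unfold ang
        rw [show 2 * Real.pi * t / N = z.arg by
          rw [ht]; field_simp]
        exact Complex.norm_mul_exp_arg_mul_I z

def flg (D : GlueingDatum 4) (f0 : Flg D) (r : ℤ) : Flg D := (rtn D ^ r) f0

theorem flg_succ (D : GlueingDatum 4) (f0 : Flg D) (r : ℤ) :
    flg D f0 (r + 1) = crs D 3 (flg D f0 r) := by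
  unfold flg
  rw [add_comm, zpow_add, zpow_one, Equiv.Perm.mul_apply]
  rfl

theorem flg_pred (D : GlueingDatum 4) (f0 : Flg D) (r : ℤ) :
    flg D f0 (r - 1) = crs D 4 (flg D f0 r) := by
  have h := flg_succ D f0 (r - 1)
  rw [sub_add_cancel] at h
  rw [h, crs_crs D 3 4 (by decide)]

theorem flg_add (D : GlueingDatum 4) (f0 : Flg D) (r q : ℤ) :
    flg D f0 (r + q) = (rtn D ^ r) (flg D f0 q) := by
  unfold flg
  rw [zpow_add, Equiv.Perm.mul_apply]

def pt (D : GlueingDatum 4) (f0 : Flg D) (r : ℤ) (x : Delta 4) : GlueSpace D :=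
  Quot.mk (glueRel D) ⟨(flg D f0 r).1, pm (flg D f0 r).2⁻¹ x⟩

theorem continuous_pt (D : GlueingDatum 4) (f0 : Flg D) (r : ℤ) : Continuous (pt D f0 r) := by
  unfold pt
  exact continuous_quot_mk.comp (continuous_sigmaMk.comp (continuous_pm _))

theorem pt_succ (D : GlueingDatum 4) (f0 : Flg D) (r : ℤ) (x : Delta 4) (hx : x.1 3 = 0) :
    pt D f0 (r + 1) (pm swp x) = pt D f0 r x := by
  unfold pt
  rw [flg_succ]
  symm
  apply Quot.sound
  refine ⟨(flg D f0 r).2 3, ?_, rfl, ?_⟩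
  · simpa [pm] using hx
  · funext v
    simp [pm, crs]

theorem pt_const (D : GlueingDatum 4) (f0 : Flg D) (r r' : ℤ) (x : Delta 4) (hx : x.1 3 = 0)
    (hx4 : x.1 4 = 0) : pt D f0 r x = pt D f0 r' x := by
  have h1 : pm swp x = x := by
    apply Subtype.ext
    funext v
    simp only [pm, Function.comp]
    have : ∀ v : Fin 5, swp v = v ∨ (swp v = 3 ∧ v = 4) ∨ (swp v = 4 ∧ v = 3) := by decide
    rcases this v with h | ⟨h, h'⟩ | ⟨h, h'⟩
    · rw [h]
    · rw [h, h', hx, hx4]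
    · rw [h, h', hx, hx4]
  have h2 : ∀ r, pt D f0 (r + 1) x = pt D f0 r x := by
    intro r
    have := pt_succ D f0 r x hx
    rwa [h1] at this
  have h3 : ∀ r, pt D f0 r x = pt D f0 0 x := by
    intro r
    induction r using Int.induction_on with
    | zero => rfl
    | succ n ih => rw [h2, ih]
    | pred n ih => rw [← ih, ← h2 (-(n : ℤ) - 1), sub_add_cancel]
  rw [h3 r, h3 r']

theorem pt_wd (D : GlueingDatum 4) (f0 : Flg D) {N : ℕ} (hN : 0 < N)
    (hper : ∀ q : ℤ, (rtn D ^ q) f0 = f0 ↔ (N : ℤ) ∣ q) (r r' : ℤ) (x x' : Delta 4)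
    (h : dd N r x.1 = dd N r' x'.1) : pt D f0 r x = pt D f0 r' x' := by
  have hflg : ∀ r m : ℤ, flg D f0 (r + N * m) = flg D f0 r := by
    intro r m
    rw [flg_add]
    have : flg D f0 (N * m) = f0 := (hper _).mpr (dvd_mul_right _ _)
    rw [this]; rfl
  have hptm : ∀ (r m : ℤ) y, pt D f0 (r + N * m) y = pt D f0 r y := by
    intro r m y
    unfold pt
    rw [hflg]
  have hs : x.1 3 + x.1 4 = x'.1 3 + x'.1 4 := by
    rw [← norm_dd_snd N r, ← norm_dd_snd N r', h]
  have hcc : cc x.1 = cc x'.1 := congrArg Prod.fst h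
  rw [cc_eq_iff] at hcc
  have hsum := delta_sum x
  have hsum' := delta_sum x'
  have e0 : x.1 0 = x'.1 0 := by linarith
  have e1 : x.1 1 = x'.1 1 := by linarith
  have e2 : x.1 2 = x'.1 2 := by linarith
  have p3 := x.2.1 3
  have p4 := x.2.1 4
  have p3' := x'.2.1 3
  have p4' := x'.2.1 4
  have hext : ∀ y y' : Delta 4, y.1 0 = y'.1 0 → y.1 1 = y'.1 1 → y.1 2 = y'.1 2 →
      y.1 3 = y'.1 3 → y.1 4 = y'.1 4 → y = y' := by
    intro y y' h0 h1 h2 h3 h4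
    apply Subtype.ext
    funext v
    have : ∀ v : Fin 5, v = 0 ∨ v = 1 ∨ v = 2 ∨ v = 3 ∨ v = 4 := by decide
    rcases this v with rfl | rfl | rfl | rfl | rfl <;> assumption
  by_cases h0 : x.1 3 + x.1 4 = 0
  · have h3 : x.1 3 = 0 := by linarith
    have h4 : x.1 4 = 0 := by linarith
    have h3' : x'.1 3 = 0 := by linarith
    have h4' : x'.1 4 = 0 := by linarith
    rw [hext x x' e0 e1 e2 (by rw [h3, h3']) (by rw [h4, h4'])]
    exact pt_const D f0 r r' x' h3' h4'
  · have h2 := congrArg Prod.snd h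
    simp only [dd] at h2
    rw [← hs] at h2
    have h3 := mul_left_cancel₀ (by exact_mod_cast h0) h2
    obtain ⟨m, hm⟩ := (ang_eq_iff hN _ _).mp h3
    have hpos : 0 < x.1 3 + x.1 4 := lt_of_le_of_ne (by linarith) (Ne.symm h0)
    have hm2 : x.1 4 / (x.1 3 + x.1 4) - x'.1 4 / (x.1 3 + x.1 4) = ((r' - r + N * m : ℤ) : ℝ) := by
      push_cast; linarith
    rw [← sub_div, div_eq_iff h0] at hm2
    have hr : r' = r + (r' - r + N * m) + N * (-m) := by ring
    generalize hk : r' - r + N * m = k at hm2 hr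
    have hk1 : k ≤ 1 := by
      by_contra hc
      have : (2 : ℝ) ≤ k := by exact_mod_cast (by omega : (2 : ℤ) ≤ k)
      nlinarith
    have hk2 : -1 ≤ k := by
      by_contra hc
      have : (k : ℝ) ≤ -2 := by exact_mod_cast (by omega : k ≤ (-2 : ℤ))
      nlinarith
    rw [hr, hptm]
    have hk3 : k = 0 ∨ k = 1 ∨ k = -1 := by omega
    have s0 : ∀ y : Delta 4, (pm swp y).1 0 = y.1 0 := fun y => rfl
    have s1 : ∀ y : Delta 4, (pm swp y).1 1 = y.1 1 := fun y => rfl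
    have s2 : ∀ y : Delta 4, (pm swp y).1 2 = y.1 2 := fun y => rfl
    have s3 : ∀ y : Delta 4, (pm swp y).1 3 = y.1 4 := fun y => rfl
    have s4 : ∀ y : Delta 4, (pm swp y).1 4 = y.1 3 := fun y => rfl
    rcases hk3 with rfl | rfl | rfl
    · rw [Int.cast_zero, zero_mul] at hm2
      rw [add_zero, hext x x' e0 e1 e2 (by linarith) (by linarith)]
    · rw [Int.cast_one, one_mul] at hm2
      have h5 : x' = pm swp x := by
        apply hext
        · rw [s0, e0]
        · rw [s1, e1]
        · rw [s2, e2]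
        · rw [s3]; linarith
        · rw [s4]; linarith
      rw [h5]
      exact (pt_succ D f0 r x (by linarith)).symm
    · rw [Int.cast_neg, Int.cast_one, neg_mul, one_mul] at hm2
      have h5 : x = pm swp x' := by
        apply hext
        · rw [s0, e0]
        · rw [s1, e1]
        · rw [s2, e2]
        · rw [s3]; linarith
        · rw [s4]; linarith
      rw [h5]
      have := pt_succ D f0 (r + -1) x' (by linarith)
      rwa [neg_add_cancel_right] at this

/-- Coordinates of the preimages of a point in the local model. -/
def AccS (D : GlueingDatum 4) (f0 : Flg D) (N : ℕ) (p : GlueTotal D) : Set (ℂ × ℂ) :=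
  {w | ∃ r : ℤ, (flg D f0 r).1 = p.1 ∧ (∀ a : Fin 5, a < 3 → 0 < p.2.1 ((flg D f0 r).2 a)) ∧
    w = dd N r (p.2.1 ∘ (flg D f0 r).2)}

theorem AccS_sub (D : GlueingDatum 4) (f0 : Flg D) (N : ℕ) {p q : GlueTotal D}
    (h : glueRel D p q) : AccS D f0 N p ⊆ AccS D f0 N q := by
  obtain ⟨i, x⟩ := p
  obtain ⟨j, y⟩ := q
  obtain ⟨k, h1, h2, h3⟩ := h
  simp only at h1 h2 h3
  rintro w ⟨r, hr, hpos, rfl⟩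
  simp only at hr hpos ⊢
  have hlt : ∀ a : Fin 5, a < 3 → swp a = a := by decide
  have hcr : ∀ v : Fin 5, (flg D f0 r).2 v = k → (crs D v (flg D f0 r)).1 = j ∧
      y.1 ∘ (crs D v (flg D f0 r)).2 = (x.1 ∘ (flg D f0 r).2) ∘ swp := by
    intro v hv
    refine ⟨?_, ?_⟩
    · simp only [crs, hv, hr]; exact h2
    · funext a
      simp only [crs, hv, hr, h3, Function.comp, Equiv.Perm.mul_apply]
      rw [Equiv.symm_apply_apply]
  have hv : ∃ v, (flg D f0 r).2 v = k := ⟨_, (flg D f0 r).2.apply_symm_apply k⟩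
  obtain ⟨v, hv⟩ := hv
  have hv34 : v = 3 ∨ v = 4 := by
    by_contra hc
    have h4 := hpos v (by omega)
    rw [hv, h1] at h4
    exact lt_irrefl _ h4
  rcases hv34 with rfl | rfl
  · obtain ⟨g1, g2⟩ := hcr 3 hv
    refine ⟨r + 1, ?_, ?_, ?_⟩
    · rw [flg_succ]; exact g1
    · intro a ha
      rw [flg_succ]
      have := congrFun g2 a
      simp only [Function.comp, hlt a ha] at this
      simp only [this]
      exact hpos a ha
    · rw [flg_succ]
      simp only [g2]
      exact (dd_swp N r _ (by simp only [Function.comp, hv, h1])).symm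
  · obtain ⟨g1, g2⟩ := hcr 4 hv
    refine ⟨r - 1, ?_, ?_, ?_⟩
    · rw [flg_pred]; exact g1
    · intro a ha
      rw [flg_pred]
      have := congrFun g2 a
      simp only [Function.comp, hlt a ha] at this
      simp only [this]
      exact hpos a ha
    · rw [flg_pred]
      simp only [g2]
      have h5 := dd_swp N (r - 1) ((x.1 ∘ (flg D f0 r).2) ∘ swp) (by
        show x.1 ((flg D f0 r).2 4) = 0
        rw [hv, h1])
      rw [← h5, sub_add_cancel]
      congr 1
      funext a
      simp

theorem AccS_eq (D : GlueingDatum 4) (f0 : Flg D) (N : ℕ) {p q : GlueTotal D}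
    (h : Quot.mk (glueRel D) p = Quot.mk (glueRel D) q) : AccS D f0 N p = AccS D f0 N q :=
  congrArg (Quot.lift (AccS D f0 N) (fun _ _ h => (AccS_sub D f0 N h).antisymm
    (AccS_sub D f0 N (glueRel_symm h)))) h

def bary0 : Delta 4 := triangleBarycentre {0, 1, 2} rfl

def Psi (D : GlueingDatum 4) (f0 : Flg D) (N : ℕ) (w : ℂ × ℂ) : GlueSpace D :=
  if h : ∃ rx : ℤ × Delta 4, dd N rx.1 rx.2.1 = w then pt D f0 h.choose.1 h.choose.2
  else pt D f0 0 bary0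

theorem Psi_dd (D : GlueingDatum 4) (f0 : Flg D) {N : ℕ} (hN : 0 < N)
    (hper : ∀ q : ℤ, (rtn D ^ q) f0 = f0 ↔ (N : ℤ) ∣ q) (r : ℤ) (x : Delta 4) :
    Psi D f0 N (dd N r x.1) = pt D f0 r x := by
  have h : ∃ rx : ℤ × Delta 4, dd N rx.1 rx.2.1 = dd N r x.1 := ⟨(r, x), rfl⟩
  unfold Psi
  rw [dif_pos h]
  exact pt_wd D f0 hN hper _ _ _ _ h.choose_spec

theorem Psi_zero (D : GlueingDatum 4) (f0 : Flg D) {N : ℕ} (hN : 0 < N)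
    (hper : ∀ q : ℤ, (rtn D ^ q) f0 = f0 ↔ (N : ℤ) ∣ q) :
    Psi D f0 N 0 = pt D f0 0 bary0 := by
  rw [← Psi_dd D f0 hN hper 0 bary0]
  congr 1
  have b0 : bary0.1 0 = 1 / 3 := by simp [bary0, triangleBarycentre]
  have b1 : bary0.1 1 = 1 / 3 := by simp [bary0, triangleBarycentre]
  have b2 : bary0.1 2 = 1 / 3 := by simp [bary0, triangleBarycentre]
  have b3 : bary0.1 3 = 0 := by simp [bary0, triangleBarycentre]
  have b4 : bary0.1 4 = 0 := by simp [bary0, triangleBarycentre]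
  ext1
  · apply Complex.ext
    · show _ = (cc bary0.1).re
      rw [cc_re, b0, b1, b2]; norm_num
    · show _ = (cc bary0.1).im
      rw [cc_im, b1, b2]; simp
  · simp [dd, b3, b4]

instance : CompactSpace (Delta 4) :=
  isCompact_iff_compactSpace.mp (isCompact_stdSimplex ℝ (Fin 5))

theorem Psi_cont (D : GlueingDatum 4) (f0 : Flg D) {N : ℕ} (hN : 0 < N)
    (hper : ∀ q : ℤ, (rtn D ^ q) f0 = f0 ↔ (N : ℤ) ∣ q) :
    ContinuousOn (Psi D f0 N) (Metric.ball 0 (1 / 20)) := by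
  rw [continuousOn_iff_isClosed]
  intro K hK
  refine ⟨⋃ r ∈ Finset.Ico (0 : ℤ) N, (fun x : Delta 4 => dd N r x.1) '' (pt D f0 r ⁻¹' K), ?_, ?_⟩
  · apply isClosed_biUnion_finset
    intro r _
    exact (((hK.preimage (continuous_pt D f0 r)).isCompact).image (continuous_dd N r)).isClosed
  · ext w
    constructor
    · rintro ⟨h1, h2⟩
      refine ⟨?_, h2⟩
      obtain ⟨r, x, rfl⟩ := exists_rep hN w h2
      have hN' : (0 : ℤ) < N := by exact_mod_cast hN
      have h3 : dd N (r % N) x.1 = dd N r x.1 := by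
        conv_rhs => rw [← Int.emod_add_mul_ediv r N]
        rw [dd_period hN]
      simp only [Set.mem_iUnion]
      refine ⟨r % N, Finset.mem_Ico.mpr ⟨Int.emod_nonneg _ hN'.ne', Int.emod_lt_of_pos _ hN'⟩,
        x, ?_, h3⟩
      show pt D f0 (r % N) x ∈ K
      rw [← Psi_dd D f0 hN hper, h3]
      exact h1
    · rintro ⟨h1, h2⟩
      refine ⟨?_, h2⟩
      simp only [Set.mem_iUnion] at h1
      obtain ⟨r, _, x, h3, rfl⟩ := h1
      show Psi D f0 N (dd N r x.1) ∈ K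
      rw [Psi_dd D f0 hN hper]
      exact h3

theorem mem_AccS_self (D : GlueingDatum 4) (f0 : Flg D) (N : ℕ) (r : ℤ) (x : Delta 4)
    (h : dd N r x.1 ∈ Metric.ball (0 : ℂ × ℂ) (1 / 20)) :
    dd N r x.1 ∈ AccS D f0 N ⟨(flg D f0 r).1, pm (flg D f0 r).2⁻¹ x⟩ := by
  obtain ⟨h0, h1, h2⟩ := rep_big h
  have hx : (pm (flg D f0 r).2⁻¹ x).1 ∘ (flg D f0 r).2 = x.1 := by
    funext a
    simp [pm]
  refine ⟨r, rfl, ?_, ?_⟩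
  · intro a ha
    have := congrFun hx a
    simp only [Function.comp] at this
    simp only [this]
    have : a = 0 ∨ a = 1 ∨ a = 2 := by omega
    rcases this with rfl | rfl | rfl <;> linarith
  · simp only [hx]

theorem Psi_open (D : GlueingDatum 4) (f0 : Flg D) {N : ℕ} (hN : 0 < N)
    (hper : ∀ q : ℤ, (rtn D ^ q) f0 = f0 ↔ (N : ℤ) ∣ q) :
    ∀ O ⊆ Metric.ball 0 (1 / 20), IsOpen O → IsOpen (Psi D f0 N '' O) := by
  intro O hO hOo
  rw [← isQuotientMap_quot_mk.isOpen_preimage, isOpen_sigma_iff]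
  intro j
  have heq : Sigma.mk j ⁻¹' (Quot.mk (glueRel D) ⁻¹' (Psi D f0 N '' O)) =
      ⋃ r : ℤ, ⋃ _ : (flg D f0 r).1 = j, (fun y => dd N r (pm (flg D f0 r).2 y).1) ⁻¹' O := by
    ext y
    simp only [Set.mem_iUnion]
    constructor
    · rintro ⟨w, hw, hwy⟩
      obtain ⟨r, x, rfl⟩ := exists_rep hN w (hO hw)
      rw [Psi_dd D f0 hN hper] at hwy
      have h1 := mem_AccS_self D f0 N r x (hO hw)
      rw [AccS_eq D f0 N hwy] at h1
      obtain ⟨r', h2, h3, h4⟩ := h1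
      refine ⟨r', h2, ?_⟩
      rw [h4] at hw
      exact hw
    · rintro ⟨r, rfl, h⟩
      refine ⟨_, h, ?_⟩
      rw [Psi_dd D f0 hN hper]
      unfold pt
      congr 2
      apply Subtype.ext
      funext a
      simp [pm]
  rw [heq]
  refine isOpen_iUnion fun r => isOpen_iUnion fun _ => ?_
  exact hOo.preimage ((continuous_dd N r).comp (continuous_pm _))

theorem Psi_fib (D : GlueingDatum 4) (f0 : Flg D) {N : ℕ} (hN : 0 < N)
    (hper : ∀ q : ℤ, (rtn D ^ q) f0 = f0 ↔ (N : ℤ) ∣ q)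
    (w : ℂ × ℂ) (hw : w ∈ Metric.ball (0 : ℂ × ℂ) (1 / 20))
    (w' : ℂ × ℂ) (hw' : w' ∈ Metric.ball (0 : ℂ × ℂ) (1 / 20)) :
    Psi D f0 N w = Psi D f0 N w' ↔ ∃ (q : ℤ) (h : Equiv.Perm (Fin 5)), fix34 h ∧
      (rtn D ^ q) f0 = Rmul h f0 ∧ w'.2 = ang N q * w.2 ∧
      ∀ x : Fin 5 → ℝ, cc x = w.1 → cc (x ∘ h) = w'.1 := by
  constructor
  · intro h
    obtain ⟨r, x, rfl⟩ := exists_rep hN w hw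
    obtain ⟨r1, x1, rfl⟩ := exists_rep hN w' hw'
    rw [Psi_dd D f0 hN hper, Psi_dd D f0 hN hper] at h
    have h1 := mem_AccS_self D f0 N r1 x1 hw'
    rw [← AccS_eq D f0 N h] at h1
    obtain ⟨r', h2, h3, h4⟩ := h1
    simp only at h2 h4
    set h := (flg D f0 r).2⁻¹ * (flg D f0 r').2 with hh
    have hx : (pm (flg D f0 r).2⁻¹ x).1 ∘ (flg D f0 r').2 = (pm h x).1 := by
      funext a
      simp [pm, hh]
    rw [hx] at h4
    rw [h4] at hw' ⊢
    obtain ⟨b0, b1, b2⟩ := rep_big hw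
    obtain ⟨c0, c1, c2⟩ := rep_big hw'
    have hsm := delta_sum x
    have p3 := x.2.1 3
    have p4 := x.2.1 4
    have hbig : ∀ a : Fin 5, 1 / 4 < x.1 a → a < 3 := by
      intro a ha
      by_contra hc
      have : a = 3 ∨ a = 4 := by omega
      rcases this with rfl | rfl <;> linarith
    have k0 := hbig _ c0
    have k1 := hbig _ c1
    have k2 := hbig _ c2
    have hge : ∀ a : Fin 5, ¬ a < 3 → ¬ h a < 3 := by
      intro a ha hc
      have i01 : h 0 ≠ h 1 := fun H => absurd (h.injective H) (by decide)
      have i02 : h 0 ≠ h 2 := fun H => absurd (h.injective H) (by decide)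
      have i12 : h 1 ≠ h 2 := fun H => absurd (h.injective H) (by decide)
      have i0a : h 0 ≠ h a := fun H => ha (by rw [← h.injective H]; decide)
      have i1a : h 1 ≠ h a := fun H => ha (by rw [← h.injective H]; decide)
      have i2a : h 2 ≠ h a := fun H => ha (by rw [← h.injective H]; decide)
      omega
    have j3 := hge 3 (by decide)
    have j4 := hge 4 (by decide)
    have i34 : h 3 ≠ h 4 := fun H => absurd (h.injective H) (by decide)
    have hflg : flg D f0 r' = Rmul h (flg D f0 r) := by
      ext1
      · exact h2
      · show (flg D f0 r').2 = (flg D f0 r).2 * h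
        rw [hh, mul_inv_cancel_left]
    have hq : (rtn D ^ (r' - r)) (flg D f0 r) = Rmul h (flg D f0 r) := by
      rw [← flg_add, sub_add_cancel, hflg]
    have hfix : fix34 h := by
      by_contra hc
      have h34 : h 3 = 4 ∧ h 4 = 3 := by
        unfold fix34 at hc
        omega
      have hg : fix34 (swp * h) := by
        constructor
        · rw [Equiv.Perm.mul_apply, h34.1]; decide
        · rw [Equiv.Perm.mul_apply, h34.2]; decide
      have := rtn_excl D hg (r' - r) (flg D f0 r)
      rw [← mul_assoc, swp_mul_self, one_mul] at this
      exact this hq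
    refine ⟨r' - r, h, hfix, ?_, ?_, ?_⟩
    · have h5 : (rtn D ^ (-r)) (Rmul h (flg D f0 r)) = Rmul h f0 := by
        rw [rtn_zpow_Rmul D hfix, ← flg_add, neg_add_cancel]; rfl
      rw [← hflg, ← flg_add] at h5
      rw [← h5]
      show _ = (rtn D ^ (-r + r')) f0
      rw [neg_add_eq_sub]
    · have e3 : (pm h x).1 3 = x.1 3 := by simp [pm, hfix.1]
      have e4 : (pm h x).1 4 = x.1 4 := by simp [pm, hfix.2]
      simp only [dd, e3, e4]
      rw [mul_left_comm, ← ang_add]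
      congr 2
      push_cast
      ring
    · intro y hy
      exact cc_perm hfix hy
  · rintro ⟨q, h, hfix, hq, hz, hc⟩
    obtain ⟨r, x, rfl⟩ := exists_rep hN w hw
    have hw'eq : w' = dd N (r + q) (pm h x).1 := by
      ext1
      · exact (hc x.1 rfl).symm
      · have e3 : (pm h x).1 3 = x.1 3 := by simp [pm, hfix.1]
        have e4 : (pm h x).1 4 = x.1 4 := by simp [pm, hfix.2]
        rw [hz]
        simp only [dd, e3, e4]
        rw [mul_left_comm, ← ang_add]
        congr 2
        push_cast
        ring
    rw [hw'eq, Psi_dd D f0 hN hper, Psi_dd D f0 hN hper]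
    have hflg : flg D f0 (r + q) = Rmul h (flg D f0 r) := by
      rw [flg_add, show flg D f0 q = Rmul h f0 from hq, rtn_zpow_Rmul D hfix]
      rfl
    unfold pt
    rw [hflg]
    congr 2
    apply Subtype.ext
    funext a
    simp [pm, Rmul]

def tri (a : Fin 3) : Fin 5 := Fin.castLE (by decide) a

theorem tri_inj : Function.Injective tri := by decide

theorem mem_range_tri (v : Fin 5) : v ∈ Set.range tri ↔ v < 3 := by
  constructor
  · rintro ⟨a, rfl⟩
    revert a; decide
  · intro h
    exact ⟨⟨v.1, by omega⟩, by apply Fin.ext; rfl⟩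

theorem ne34_iff : ∀ v : Fin 5, v < 3 ↔ v ≠ 3 ∧ v ≠ 4 := by decide

theorem fix34_eq_one {h : Equiv.Perm (Fin 5)} (hh : fix34 h) (h3 : ∀ a : Fin 3, h (tri a) = tri a) :
    h = 1 := by
  ext1 v
  by_cases hv : v < 3
  · obtain ⟨a, rfl⟩ := (mem_range_tri v).2 hv
    exact h3 a
  · have : ∀ v : Fin 5, ¬ v < 3 → v = 3 ∨ v = 4 := by decide
    rcases this v hv with rfl | rfl
    · exact hh.1
    · exact hh.2

theorem fix34_range {h : Equiv.Perm (Fin 5)} (hh : fix34 h) :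
    Set.range (h ∘ tri) = Set.range tri := by
  have hsub : ∀ v, v < 3 → h v < 3 := hh.lt
  have hinv : ∀ v, v < 3 → h.symm v < 3 := by
    intro v hv
    rw [ne34_iff] at hv ⊢
    constructor
    · intro e
      apply hv.1
      rw [Equiv.symm_apply_eq, hh.1] at e
      exact e
    · intro e
      apply hv.2
      rw [Equiv.symm_apply_eq, hh.2] at e
      exact e
  ext v
  constructor
  · rintro ⟨a, rfl⟩
    rw [mem_range_tri]
    exact hsub _ ((mem_range_tri _).1 ⟨a, rfl⟩)
  · intro hv
    obtain ⟨a, ha⟩ := (mem_range_tri _).2 (hinv v ((mem_range_tri v).1 hv))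
    exact ⟨a, by simp [ha]⟩

theorem crs_step (D : GlueingDatum 4) (f : Flg D) :
    D.P (f.1, f.2 3) = ((crs D 3 f).1, (crs D 3 f).2 4) := by
  ext1
  · rfl
  · have e : swp 4 = 3 := by decide
    simp only [crs, Equiv.Perm.mul_apply, e]
    exact (D.glue_face _).symm

theorem crs_tri (D : GlueingDatum 4) (f : Flg D) (a : Fin 3) :
    (crs D 3 f).2 (tri a) = D.glue (f.1, f.2 3) (f.2 (tri a)) := by
  have e : ∀ a, swp (tri a) = tri a := by decide
  simp only [crs, Equiv.Perm.mul_apply, e]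

theorem cycl_trivial (D : GlueingDatum 4) (hC : Cycl D) (f0 : Flg D) {N : ℕ} (hN : 0 < N)
    (hper : ∀ q : ℤ, (rtn D ^ q) f0 = f0 ↔ (N : ℤ) ∣ q) (q : ℤ) (h : Equiv.Perm (Fin 5))
    (hh : fix34 h) (hq : (rtn D ^ q) f0 = Rmul h f0) : h = 1 := by
  obtain ⟨m, hm, hmq⟩ : ∃ m : ℕ, 1 ≤ m ∧ (rtn D ^ (m : ℤ)) f0 = Rmul h f0 := by
    refine ⟨(q + N * (|q| + 1)).toNat, ?_, ?_⟩
    · have : 1 ≤ q + N * (|q| + 1) := by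
        have h1 := neg_abs_le q
        have h2 : (1 : ℤ) ≤ N := by exact_mod_cast hN
        nlinarith [abs_nonneg q]
      omega
    · have h0 : 0 ≤ q + N * (|q| + 1) := by
        have h1 := neg_abs_le q
        have h2 : (1 : ℤ) ≤ N := by exact_mod_cast hN
        nlinarith [abs_nonneg q]
      rw [Int.toNat_of_nonneg h0, zpow_add, Equiv.Perm.mul_apply, (hper _).2 (dvd_mul_right _ _), hq]
  have hfm : flg D f0 m = Rmul h f0 := hmq
  have hf0 : flg D f0 (0 : ℕ) = f0 := rfl
  have key := hC m hm (fun r => (flg D f0 r).1) (fun r a => (flg D f0 r).2 (tri a))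
    (fun r => (flg D f0 r).2 3) (fun r => (flg D f0 r).2 4)
    (fun r _ => (flg D f0 r).2.injective.comp tri_inj)
    (fun r _ => by
      rintro ⟨a, ha⟩
      have h1 : tri a = 3 := (flg D f0 r).2.injective ha
      clear ha
      revert h1; revert a; decide)
    (fun r _ => by
      push_cast
      rw [flg_succ]
      exact crs_step D _)
    (fun r _ => by
      push_cast
      rw [flg_succ]
      funext a
      exact crs_tri D _ a)
    (fun r _ _ e => by
      have := (flg D f0 r).2.injective e
      revert this; decide)
    (by simp only [hfm, hf0]; rfl)
    (by
      simp only [hfm, hf0, Rmul, Equiv.Perm.mul_apply]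
      have h1 := congrArg (Set.image f0.2) (fix34_range hh)
      rw [← Set.range_comp, ← Set.range_comp] at h1
      exact h1)
    (by
      simp only [hfm, hf0, Rmul, Equiv.Perm.mul_apply, hh.2]
      intro e
      have := f0.2.injective e
      revert this; decide)
  apply fix34_eq_one hh
  intro a
  have := congrFun key a
  simp only [hfm, hf0, Rmul, Equiv.Perm.mul_apply] at this
  exact f0.2.injective this

theorem pt_bary (D : GlueingDatum 4) (f0 : Flg D) (s : Finset (Fin 5)) (hs : s.card = 3)
    (h : ∀ v, f0.2 v ∈ s ↔ v < 3) :
    pt D f0 0 bary0 = Quot.mk (glueRel D) ⟨f0.1, triangleBarycentre s hs⟩ := by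
  have hf0 : flg D f0 0 = f0 := rfl
  unfold pt
  rw [hf0]
  congr 2
  apply Subtype.ext
  funext v
  obtain ⟨u, rfl⟩ := f0.2.surjective v
  have e : ∀ u : Fin 5, u ∈ ({0, 1, 2} : Finset (Fin 5)) ↔ u < 3 := by decide
  simp only [pm, bary0, triangleBarycentre, Function.comp, e, h]
  rw [show f0.2⁻¹ (f0.2 u) = u from f0.2.symm_apply_apply u]

theorem exists_perm (s : Finset (Fin 5)) (hs : s.card = 3) :
    ∃ e : Equiv.Perm (Fin 5), ∀ v, e v ∈ s ↔ v < 3 := by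
  have h1 : Fintype.card {v : Fin 5 // v < 3} = Fintype.card {v : Fin 5 // v ∈ s} := by
    rw [Fintype.card_coe, hs]
    simp only [Fintype.card_subtype]
    decide
  let e0 : {v : Fin 5 // v < 3} ≃ {v : Fin 5 // v ∈ s} := Fintype.equivOfCardEq h1
  refine ⟨e0.extendSubtype, fun v => ?_⟩
  by_cases hv : v < 3
  · exact iff_of_true (e0.extendSubtype_mem v hv) hv
  · exact iff_of_false (e0.extendSubtype_not_mem v hv) hv

theorem euclid_of_cycl (D : GlueingDatum 4) (hC : Cycl D) (i : D.I) (s : Finset (Fin 5))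
    (hs : s.card = 3) :
    ∃ U : Set (GlueSpace D), IsOpen U ∧
          Quot.mk (glueRel D) ⟨i, triangleBarycentre s hs⟩ ∈ U ∧
          Nonempty (↥U ≃ₜ EuclideanSpace ℝ (Fin 4)) := by
  obtain ⟨e, he⟩ := exists_perm s hs
  obtain ⟨N, hN, hper⟩ := exists_period D (i, e)
  have h := euclid_of_inj (Psi D (i, e) N) (1 / 20) (by norm_num) (Psi_cont D _ hN hper)
    (Psi_open D _ hN hper) (by
      intro w hw w' hw' heq
      rw [Psi_fib D _ hN hper w hw w' hw'] at heq
      obtain ⟨q, h, hh, hq, h1, h2⟩ := heq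
      have h0 := cycl_trivial D hC _ hN hper q h hh hq
      subst h0
      rw [Rmul_one, hper] at hq
      obtain ⟨m, rfl⟩ := hq
      have ha : ang N ((N * m : ℤ) : ℝ) = 1 := by
        rw [show (1 : ℂ) = ang N 0 by simp [ang], ang_eq_iff hN]
        exact ⟨m, by push_cast; ring⟩
      rw [ha, one_mul] at h1
      obtain ⟨r, x, hx⟩ := exists_rep hN w hw
      have h3 : cc x.1 = w.1 := congrArg Prod.fst hx
      have h4 := h2 x.1 h3
      rw [show x.1 ∘ (1 : Equiv.Perm (Fin 5)) = x.1 from rfl, h3] at h4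
      exact Prod.ext h4 h1.symm)
  rw [Psi_zero D _ hN hper, pt_bary D (i, e) s hs he] at h
  exact h

theorem exists_flag_perm (t : Fin 3 → Fin 5) (ht : Function.Injective t) (k : Fin 5)
    (hk : k ∉ Set.range t) :
    ∃ e : Equiv.Perm (Fin 5), (∀ a, e (tri a) = t a) ∧ e 3 = k := by
  let f : Fin 5 → Fin 5 := fun v => if h : v < 3 then t ⟨v.1, by omega⟩ else k
  have hf1 : ∀ a, f (tri a) = t a := by
    intro a
    have h : tri a < 3 := (mem_range_tri _).1 ⟨a, rfl⟩
    simp only [f, dif_pos h]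
    rfl
  have hf2 : f 3 = k := by
    simp only [f]
    rw [dif_neg (by decide)]
  have hcases : ∀ v : Fin 5, v ∈ ({0, 1, 2, 3} : Finset (Fin 5)) → v < 3 ∨ v = 3 := by decide
  have hinj : Set.InjOn f (({0, 1, 2, 3} : Finset (Fin 5)) : Set (Fin 5)) := by
    intro v hv w hw hvw
    rcases hcases v hv with h1 | rfl <;> rcases hcases w hw with h2 | rfl
    · obtain ⟨a, rfl⟩ := (mem_range_tri v).2 h1
      obtain ⟨b, rfl⟩ := (mem_range_tri w).2 h2
      rw [hf1, hf1] at hvw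
      rw [ht hvw]
    · obtain ⟨a, rfl⟩ := (mem_range_tri v).2 h1
      rw [hf1, hf2] at hvw
      exact absurd ⟨a, hvw⟩ hk
    · obtain ⟨a, rfl⟩ := (mem_range_tri w).2 h2
      rw [hf1, hf2] at hvw
      exact absurd ⟨a, hvw.symm⟩ hk
    · rfl
  obtain ⟨g, hg⟩ := Finset.exists_equiv_extend_of_card_eq (α := Fin 5) (t := Finset.univ)
    (by simp) (Finset.subset_univ _) hinj
  refine ⟨g.trans (Equiv.subtypeUnivEquiv (fun x => Finset.mem_univ x)), fun a => ?_, ?_⟩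
  · have h1 : ∀ a : Fin 3, tri a ∈ ({0, 1, 2, 3} : Finset (Fin 5)) := by decide
    exact (hg _ (h1 a)).trans (hf1 a)
  · exact (hg 3 (by decide)).trans hf2

theorem not_tri {e : Equiv.Perm (Fin 5)} {t : Fin 3 → Fin 5} (he : ∀ a, e (tri a) = t a)
    {v : Fin 5} (hv : v ∉ Set.range t) : v = e 3 ∨ v = e 4 := by
  obtain ⟨u, rfl⟩ := e.surjective v
  have h1 : ∀ u : Fin 5, u < 3 ∨ u = 3 ∨ u = 4 := by decide
  rcases h1 u with h | rfl | rfl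
  · obtain ⟨a, rfl⟩ := (mem_range_tri u).2 h
    exact absurd ⟨a, (he a).symm⟩ hv
  · exact Or.inl rfl
  · exact Or.inr rfl

theorem tri_not {e : Equiv.Perm (Fin 5)} {t : Fin 3 → Fin 5} (he : ∀ a, e (tri a) = t a)
    {u : Fin 5} (hu : ¬ u < 3) : e u ∉ Set.range t := by
  rintro ⟨a, ha⟩
  rw [← he] at ha
  exact hu ((mem_range_tri u).1 ⟨a, e.injective ha⟩)

theorem follow (D : GlueingDatum 4) (hC : ¬ Cycl D) :
    ∃ (f0 : Flg D) (q : ℤ) (g : Equiv.Perm (Fin 5)), fix34 g ∧ g ≠ 1 ∧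
      (rtn D ^ q) f0 = Rmul g f0 := by
  unfold Cycl at hC
  push Not at hC
  obtain ⟨m, hm, i, t, k, l, hinj, hk, hP, ht, hkl, him, hrange, hlk, hne⟩ := hC
  obtain ⟨e, he1, he2⟩ := exists_flag_perm (t 0) (hinj 0 (by omega)) (k 0) (hk 0 (by omega))
  have main : ∀ r : ℕ, r ≤ m → (flg D (i 0, e) r).1 = i r ∧
      (∀ a, (flg D (i 0, e) r).2 (tri a) = t r a) ∧
      (r < m → (flg D (i 0, e) r).2 3 = k r) ∧ (0 < r → (flg D (i 0, e) r).2 4 = l r) := by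
    intro r
    induction r with
    | zero =>
      intro _
      exact ⟨rfl, he1, fun _ => he2, fun h => absurd h (lt_irrefl _)⟩
    | succ r ih =>
      intro hr
      obtain ⟨h1, h2, h3, -⟩ := ih (by omega)
      have h3 := h3 (by omega)
      push_cast
      rw [flg_succ]
      have hs := crs_step D (flg D (i 0, e) r)
      rw [h1, h3, hP r (by omega)] at hs
      have a1 := (congrArg Prod.fst hs).symm
      have a4 := (congrArg Prod.snd hs).symm
      simp only at a1 a4
      have a2 : ∀ a, (crs D 3 (flg D (i 0, e) r)).2 (tri a) = t (r + 1) a := by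
        intro a
        rw [crs_tri, h1, h3, h2, ht r (by omega)]
        rfl
      refine ⟨a1, a2, fun hr' => ?_, fun _ => a4⟩
      rcases not_tri a2 (hk (r + 1) hr') with h | h
      · exact h.symm
      · rw [a4] at h
        exact absurd h (hkl (r + 1) (by omega) hr')
  obtain ⟨h1, h2, -, h4⟩ := main m le_rfl
  have h4 := h4 (by omega)
  set F := flg D (i 0, e) m with hF
  have hl : F.2 4 = e 4 := by
    have h5 : F.2 4 ∉ Set.range (t 0) := by
      rw [← hrange]
      exact tri_not h2 (by decide)
    rcases not_tri he1 h5 with h | h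
    · rw [h4, he2] at h
      exact absurd h hlk
    · exact h
  have hl3 : F.2 3 = e 3 := by
    have h5 : F.2 3 ∉ Set.range (t 0) := by
      rw [← hrange]
      exact tri_not h2 (by decide)
    rcases not_tri he1 h5 with h | h
    · exact h
    · rw [← hl] at h
      have h6 : (3 : Fin 5) = 4 := F.2.injective h
      exact absurd h6 (by decide)
  refine ⟨(i 0, e), m, e⁻¹ * F.2, ⟨?_, ?_⟩, ?_, ?_⟩
  · rw [Equiv.Perm.mul_apply, hl3]; exact e.symm_apply_apply 3
  · rw [Equiv.Perm.mul_apply, hl]; exact e.symm_apply_apply 4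
  · intro h
    apply hne
    rw [inv_mul_eq_one] at h
    funext a
    rw [← h2, ← he1, ← h]
  · show F = _
    ext1
    · exact h1.trans him
    · show F.2 = e * (e⁻¹ * F.2)
      rw [mul_inv_cancel_left]

def sgm : Equiv.Perm (Fin 5) := Equiv.swap 0 1 * Equiv.swap 0 2

theorem fix34_ext {g h : Equiv.Perm (Fin 5)} (hg : fix34 g) (hh : fix34 h) (h0 : g 0 = h 0)
    (h1 : g 1 = h 1) (h2 : g 2 = h 2) : g = h := by
  ext1 v
  have : ∀ v : Fin 5, v = 0 ∨ v = 1 ∨ v = 2 ∨ v = 3 ∨ v = 4 := by decide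
  rcases this v with rfl | rfl | rfl | rfl | rfl
  · exact h0
  · exact h1
  · exact h2
  · rw [hg.1, hh.1]
  · rw [hg.2, hh.2]

theorem sgm_facts : sgm 0 = 2 ∧ sgm 1 = 0 ∧ sgm 2 = 1 ∧ fix34 sgm ∧ sgm ^ 3 = 1 := by
  unfold fix34; decide

theorem fix34_class {h : Equiv.Perm (Fin 5)} (hh : fix34 h) (hne : h ≠ 1) :
    (∃ g, fix34 g ∧ g⁻¹ * h * g = Equiv.swap 1 2) ∨ ∃ g, fix34 g ∧ g⁻¹ * h * g = sgm := by
  have h0 := hh.lt 0 (by decide)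
  have h1 := hh.lt 1 (by decide)
  have h2 := hh.lt 2 (by decide)
  have n01 : h 0 ≠ h 1 := fun e => by have := h.injective e; revert this; decide
  have n02 : h 0 ≠ h 2 := fun e => by have := h.injective e; revert this; decide
  have n12 : h 1 ≠ h 2 := fun e => by have := h.injective e; revert this; decide
  have key : ∀ a b c : Fin 5, a < 3 → b < 3 → c < 3 → a ≠ b → a ≠ c → b ≠ c →
      (a = 0 ∧ b = 1 ∧ c = 2) ∨ (a = 0 ∧ b = 2 ∧ c = 1) ∨ (a = 1 ∧ b = 0 ∧ c = 2) ∨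
      (a = 2 ∧ b = 1 ∧ c = 0) ∨ (a = 2 ∧ b = 0 ∧ c = 1) ∨ (a = 1 ∧ b = 2 ∧ c = 0) := by
    have L : ∀ a : Fin 5, a < 3 → a = 0 ∨ a = 1 ∨ a = 2 := by decide
    intro a b c ha hb hc
    rcases L a ha with rfl | rfl | rfl <;> rcases L b hb with rfl | rfl | rfl <;>
      rcases L c hc with rfl | rfl | rfl <;> simp
  rcases key _ _ _ h0 h1 h2 n01 n02 n12 with ⟨a, b, c⟩ | ⟨a, b, c⟩ | ⟨a, b, c⟩ | ⟨a, b, c⟩ |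
    ⟨a, b, c⟩ | ⟨a, b, c⟩
  · exact absurd (fix34_ext hh ⟨rfl, rfl⟩ a b c) hne
  · rw [fix34_ext (h := Equiv.swap 1 2) hh (by unfold fix34; decide) (a.trans (by decide))
      (b.trans (by decide)) (c.trans (by decide))]
    exact Or.inl ⟨1, ⟨rfl, rfl⟩, by decide⟩
  · rw [fix34_ext (h := Equiv.swap 0 1) hh (by unfold fix34; decide) (a.trans (by decide))
      (b.trans (by decide)) (c.trans (by decide))]
    exact Or.inl ⟨Equiv.swap 0 2, by unfold fix34; decide, by decide⟩
  · rw [fix34_ext (h := Equiv.swap 0 2) hh (by unfold fix34; decide) (a.trans (by decide))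
      (b.trans (by decide)) (c.trans (by decide))]
    exact Or.inl ⟨Equiv.swap 0 1, by unfold fix34; decide, by decide⟩
  · rw [fix34_ext (h := sgm) hh (by unfold fix34; decide) (a.trans (by decide))
      (b.trans (by decide)) (c.trans (by decide))]
    exact Or.inr ⟨1, ⟨rfl, rfl⟩, by decide⟩
  · rw [fix34_ext (h := sgm⁻¹) hh (by unfold fix34; decide) (a.trans (by decide))
      (b.trans (by decide)) (c.trans (by decide))]
    exact Or.inr ⟨Equiv.swap 1 2, by unfold fix34; decide, by decide⟩

theorem fix34.mul {g h : Equiv.Perm (Fin 5)} (hg : fix34 g) (hh : fix34 h) : fix34 (g * h) :=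
  ⟨by rw [Equiv.Perm.mul_apply, hh.1, hg.1], by rw [Equiv.Perm.mul_apply, hh.2, hg.2]⟩

theorem fix34.inv {g : Equiv.Perm (Fin 5)} (hg : fix34 g) : fix34 g⁻¹ :=
  ⟨by rw [Equiv.Perm.inv_eq_iff_eq, hg.1], by rw [Equiv.Perm.inv_eq_iff_eq, hg.2]⟩

theorem rtn_comp (D : GlueingDatum 4) {f0 : Flg D} {p q : ℤ} {a b : Equiv.Perm (Fin 5)}
    (hb : fix34 b) (hp : (rtn D ^ p) f0 = Rmul a f0) (hq : (rtn D ^ q) f0 = Rmul b f0) :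
    (rtn D ^ (p + q)) f0 = Rmul (a * b) f0 := by
  rw [zpow_add, Equiv.Perm.mul_apply, hq, rtn_zpow_Rmul D hb, hp, Rmul_Rmul]

theorem rtn_neg (D : GlueingDatum 4) {f0 : Flg D} {p : ℤ} {a : Equiv.Perm (Fin 5)}
    (ha : fix34 a) (hp : (rtn D ^ p) f0 = Rmul a f0) :
    (rtn D ^ (-p)) f0 = Rmul a⁻¹ f0 := by
  rw [zpow_neg, Equiv.Perm.inv_eq_iff_eq, rtn_zpow_Rmul D ha.inv, hp, Rmul_Rmul, mul_inv_cancel,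
    Rmul_one]

/-- `M` generates the stabiliser of the triangle, with return map `h`. -/
def Gen (D : GlueingDatum 4) (f0 : Flg D) (M : ℤ) (h : Equiv.Perm (Fin 5)) : Prop :=
  fix34 h ∧ (rtn D ^ M) f0 = Rmul h f0 ∧
    ∀ q a, fix34 a → (rtn D ^ q) f0 = Rmul a f0 → ∃ k : ℤ, q = k * M

theorem Gen.neg {D : GlueingDatum 4} {f0 : Flg D} {M : ℤ} {h : Equiv.Perm (Fin 5)}
    (hG : Gen D f0 M h) : Gen D f0 (-M) h⁻¹ := by
  refine ⟨hG.1.inv, rtn_neg D hG.1 hG.2.1, fun q a ha hq => ?_⟩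
  obtain ⟨k, hk⟩ := hG.2.2 q a ha hq
  exact ⟨-k, by rw [hk]; ring⟩

theorem Gen.conj {D : GlueingDatum 4} {f0 : Flg D} {M : ℤ} {h : Equiv.Perm (Fin 5)}
    (hG : Gen D f0 M h) {g : Equiv.Perm (Fin 5)} (hg : fix34 g) :
    Gen D (Rmul g f0) M (g⁻¹ * h * g) := by
  refine ⟨(hg.inv.mul hG.1).mul hg, ?_, fun q a ha hq => ?_⟩
  · rw [rtn_zpow_Rmul D hg, hG.2.1, Rmul_Rmul, Rmul_Rmul, mul_assoc, mul_inv_cancel_left]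
  · apply hG.2.2 q (g * a * g⁻¹) ((hg.mul ha).mul hg.inv)
    rw [rtn_zpow_Rmul D hg, Rmul_Rmul] at hq
    have := congrArg (Rmul g⁻¹) hq
    rwa [Rmul_Rmul, Rmul_Rmul, mul_inv_cancel, Rmul_one] at this

theorem Gen.pow {D : GlueingDatum 4} {f0 : Flg D} {M : ℤ} {h : Equiv.Perm (Fin 5)}
    (hG : Gen D f0 M h) (k : ℕ) : fix34 (h ^ k) ∧ (rtn D ^ ((k : ℤ) * M)) f0 = Rmul (h ^ k) f0 := by
  induction k with
  | zero => exact ⟨⟨rfl, rfl⟩, by simp [Rmul_one]⟩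
  | succ k ih =>
    rw [pow_succ]
    refine ⟨ih.1.mul hG.1, ?_⟩
    rw [← rtn_comp D hG.1 ih.2 hG.2.1]
    push_cast
    rw [add_mul, one_mul]

theorem Gen.zpow {D : GlueingDatum 4} {f0 : Flg D} {M : ℤ} {h : Equiv.Perm (Fin 5)}
    (hG : Gen D f0 M h) (k : ℤ) : fix34 (h ^ k) ∧ (rtn D ^ (k * M)) f0 = Rmul (h ^ k) f0 := by
  obtain ⟨n, rfl | rfl⟩ := k.eq_nat_or_neg
  · rw [zpow_natCast]; exact hG.pow n
  · have := hG.pow n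
    rw [zpow_neg, zpow_natCast, neg_mul]
    exact ⟨this.1.inv, rtn_neg D this.1 this.2⟩

theorem exists_gen (D : GlueingDatum 4) {f0 : Flg D} {q : ℤ} {g : Equiv.Perm (Fin 5)}
    (hg : fix34 g) (hne : g ≠ 1) (hq : (rtn D ^ q) f0 = Rmul g f0) :
    ∃ M h, h ≠ 1 ∧ Gen D f0 M h := by
  let K : AddSubgroup ℤ :=
    { carrier := {q | ∃ a, fix34 a ∧ (rtn D ^ q) f0 = Rmul a f0}
      zero_mem' := ⟨1, ⟨rfl, rfl⟩, by rw [Rmul_one]; rfl⟩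
      add_mem' := by
        rintro p q ⟨a, ha, hp⟩ ⟨b, hb, hq⟩
        exact ⟨a * b, ha.mul hb, rtn_comp D hb hp hq⟩
      neg_mem' := by
        rintro p ⟨a, ha, hp⟩
        exact ⟨a⁻¹, ha.inv, rtn_neg D ha hp⟩ }
  obtain ⟨M, hM⟩ := Int.subgroup_cyclic K
  have hMm : M ∈ K := by rw [hM]; exact AddSubgroup.mem_closure_singleton_self M
  obtain ⟨h, hh, hMh⟩ := hMm
  have hG : Gen D f0 M h := by
    refine ⟨hh, hMh, fun q a ha hq => ?_⟩
    have : q ∈ K := ⟨a, ha, hq⟩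
    rw [hM, AddSubgroup.mem_closure_singleton] at this
    obtain ⟨k, hk⟩ := this
    exact ⟨k, by rw [← hk, smul_eq_mul]⟩
  refine ⟨M, h, ?_, hG⟩
  rintro rfl
  obtain ⟨k, rfl⟩ := hG.2.2 q g hg hq
  apply hne
  have := (hG.zpow k).2
  rw [one_zpow, hq] at this
  exact Rmul_inj this

theorem ang_zpow (N : ℕ) (M k : ℤ) :
    ang N ((k * M : ℤ) : ℝ) = ang N M ^ k := by
  unfold ang
  rw [← Complex.exp_int_mul]
  congr 1
  push_cast
  ring

theorem ang_eq_one {N : ℕ} (hN : 0 < N) (q : ℤ) : ang N q = 1 ↔ (N : ℤ) ∣ q := by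
  rw [show (1 : ℂ) = ang N 0 by simp [ang], ang_eq_iff hN]
  apply exists_congr
  intro m
  rw [zero_add]
  exact_mod_cast Iff.rfl

theorem cc_surj (c : ℂ) : ∃ x, cc x = c := by
  have h3 : √3 ≠ 0 := by positivity
  refine ⟨![2 / 3 * c.re, -c.re / 3 + c.im / √3, -c.re / 3 - c.im / √3, 0, 0], ?_⟩
  rw [Complex.ext_iff, cc_re, cc_im]
  constructor
  · simp; ring
  · simp; field_simp; ring

theorem cc_swap (x : Fin 5 → ℝ) : cc (x ∘ Equiv.swap 1 2) = (starRingEnd ℂ) (cc x) := by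
  have e0 : Equiv.swap (1 : Fin 5) 2 0 = 0 := by decide
  have e1 : Equiv.swap (1 : Fin 5) 2 1 = 2 := by decide
  have e2 : Equiv.swap (1 : Fin 5) 2 2 = 1 := by decide
  rw [Complex.ext_iff, Complex.conj_re, Complex.conj_im, cc_re, cc_im, cc_re, cc_im]
  simp only [Function.comp, e0, e1, e2]
  constructor <;> ring

theorem cc_sgm (x : Fin 5 → ℝ) : cc (x ∘ sgm) = omg * cc x := by
  obtain ⟨e0, e1, e2, -⟩ := sgm_facts
  simp only [cc, Function.comp, e0, e1, e2]
  linear_combination (-(x 2 : ℂ)) * omg_pow_three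

theorem cc_sgm_pow (x : Fin 5 → ℝ) (k : ℕ) : cc (x ∘ (sgm ^ k : Equiv.Perm (Fin 5))) = omg ^ k * cc x := by
  induction k with
  | zero => simp
  | succ k ih =>
    have : x ∘ (sgm ^ (k + 1) : Equiv.Perm (Fin 5)) = (x ∘ (sgm ^ k : Equiv.Perm (Fin 5))) ∘ sgm := by
      rw [pow_succ]; rfl
    rw [this, cc_sgm, ih, pow_succ]
    ring

theorem chart_of_euclid (D : GlueingDatum 4)
    (hE : ∀ (i : D.I) (s : Finset (Fin 5)) (hs : s.card = 3),
        ∃ U : Set (GlueSpace D), IsOpen U ∧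
          Quot.mk (glueRel D) ⟨i, triangleBarycentre s hs⟩ ∈ U ∧
          Nonempty (↥U ≃ₜ EuclideanSpace ℝ (Fin 4))) (f0 : Flg D) {N : ℕ} (hN : 0 < N)
    (hper : ∀ q : ℤ, (rtn D ^ q) f0 = f0 ↔ (N : ℤ) ∣ q) :
    ∃ δ' : ℝ, δ' ≤ 1 / 20 ∧ 0 < δ' ∧ ∃ Φ : ℂ × ℂ → EuclideanSpace ℝ (Fin 4),
      ContinuousOn Φ (Metric.ball 0 δ') ∧
      (∀ O ⊆ Metric.ball 0 δ', IsOpen O → IsOpen (Φ '' O)) ∧ Φ 0 = 0 ∧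
      ∀ w ∈ Metric.ball 0 δ', ∀ w' ∈ Metric.ball 0 δ',
        (Φ w = Φ w' ↔ Psi D f0 N w = Psi D f0 N w') := by
  have hs : (Finset.image f0.2 {0, 1, 2}).card = 3 := by
    rw [Finset.card_image_of_injective _ f0.2.injective]; rfl
  obtain ⟨U, hU, h0, ⟨χ⟩⟩ := hE f0.1 (Finset.image f0.2 {0, 1, 2}) hs
  rw [← pt_bary D f0 _ hs, ← Psi_zero D f0 hN hper] at h0
  · exact chart_reduce _ (1 / 20) (by norm_num) (Psi_cont D f0 hN hper) (Psi_open D f0 hN hper)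
      U hU h0 χ
  · intro v
    have e : ∀ u : Fin 5, u ∈ ({0, 1, 2} : Finset (Fin 5)) ↔ u < 3 := by decide
    rw [← e, Function.Injective.mem_finset_image f0.2.injective]

def EuclidAll (D : GlueingDatum 4) : Prop :=
  ∀ (i : D.I) (s : Finset (Fin 5)) (hs : s.card = 3),
        ∃ U : Set (GlueSpace D), IsOpen U ∧
          Quot.mk (glueRel D) ⟨i, triangleBarycentre s hs⟩ ∈ U ∧
          Nonempty (↥U ≃ₜ EuclideanSpace ℝ (Fin 4))

theorem Gen.dvd {D : GlueingDatum 4} {f0 : Flg D} {M : ℤ} {h : Equiv.Perm (Fin 5)}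
    (hG : Gen D f0 M h) {N : ℕ} (hN : 0 < N)
    (hper : ∀ q : ℤ, (rtn D ^ q) f0 = f0 ↔ (N : ℤ) ∣ q) (k : ℤ) :
    ang N M ^ k = 1 ↔ h ^ k = 1 := by
  rw [← ang_zpow, ang_eq_one hN, ← hper, (hG.zpow k).2]
  constructor
  · intro e
    apply Rmul_inj (f := f0)
    rw [e, Rmul_one]
  · intro e
    rw [e, Rmul_one]

theorem no_two (D : GlueingDatum 4) (hE : EuclidAll D) (f0 : Flg D) {N : ℕ} (hN : 0 < N)
    (hper : ∀ q : ℤ, (rtn D ^ q) f0 = f0 ↔ (N : ℤ) ∣ q) {M : ℤ}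
    (hG : Gen D f0 M (Equiv.swap 1 2)) : False := by
  have hsq : (Equiv.swap (1 : Fin 5) 2) ^ (2 : ℤ) = 1 := by
    rw [zpow_ofNat, pow_two, Equiv.swap_mul_self]
  have hne : Equiv.swap (1 : Fin 5) 2 ≠ 1 := by decide
  have ha : ang N M = -1 := by
    have h1 := (hG.dvd hN hper 2).2 hsq
    rw [zpow_ofNat, sq_eq_one_iff] at h1
    rcases h1 with h1 | h1
    · have h2 := (hG.dvd hN hper 1).1 (by rw [zpow_one, h1])
      rw [zpow_one] at h2
      exact absurd h2 hne
    · exact h1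
  obtain ⟨δ, hδ1, hδ, Φ, hc, ho, h0, hfib⟩ := chart_of_euclid D hE f0 hN hper
  apply no_chart_two (by simp) Φ δ hδ hc ho h0
  intro w hw w' hw'
  have hb := Metric.ball_subset_ball (x := (0 : ℂ × ℂ)) hδ1
  rw [hfib w hw w' hw', Psi_fib D f0 hN hper w (hb hw) w' (hb hw')]
  constructor
  · rintro ⟨q, h, hh, hq, h1, h2⟩
    obtain ⟨k, rfl⟩ := hG.2.2 q h hh hq
    rw [(hG.zpow k).2] at hq
    have hk := Rmul_inj hq
    obtain ⟨x, hx⟩ := cc_surj w.1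
    have h3 := h2 x hx
    rw [ang_zpow, ha] at h1
    rcases Int.even_or_odd' k with ⟨j, rfl | rfl⟩
    · left
      rw [zpow_mul, hsq, one_zpow] at hk
      subst hk
      rw [zpow_mul, show (-1 : ℂ) ^ (2 : ℤ) = 1 by norm_num, one_zpow, one_mul] at h1
      exact Prod.ext (by rw [← h3, ← hx]; rfl) h1
    · right
      rw [zpow_add, zpow_mul, hsq, one_zpow, one_mul, zpow_one] at hk
      subst hk
      rw [zpow_add₀ (by norm_num), zpow_mul, show (-1 : ℂ) ^ (2 : ℤ) = 1 by norm_num, one_zpow,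
        one_mul, zpow_one, neg_one_mul] at h1
      exact Prod.ext (by rw [← h3, cc_swap, hx]; rfl) h1
  · rintro (rfl | rfl)
    · refine ⟨0, 1, ⟨rfl, rfl⟩, by rw [Rmul_one]; rfl, by simp [ang], fun x hx => hx⟩
    · refine ⟨M, Equiv.swap 1 2, hG.1, hG.2.1, by rw [ha]; simp [tauTwo], fun x hx => ?_⟩
      rw [cc_swap, hx]; rfl

theorem no_three (D : GlueingDatum 4) (hE : EuclidAll D) (f0 : Flg D) {N : ℕ} (hN : 0 < N)
    (hper : ∀ q : ℤ, (rtn D ^ q) f0 = f0 ↔ (N : ℤ) ∣ q) {M : ℤ}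
    (hG : Gen D f0 M sgm) (ha : ang N M = omg) : False := by
  have hs3 : sgm ^ (3 : ℤ) = 1 := by
    rw [zpow_ofNat]; exact sgm_facts.2.2.2.2
  have ho3 : omg ^ (3 : ℤ) = 1 := by
    rw [zpow_ofNat]; exact omg_pow_three
  have hom : omg ≠ 0 := omg_prim.ne_zero (by norm_num)
  obtain ⟨δ, hδ1, hδ, Φ, hc, ho, h0, hfib⟩ := chart_of_euclid D hE f0 hN hper
  apply no_chart_three (by simp) Φ δ hδ hc ho h0
  intro w hw w' hw'
  have hb := Metric.ball_subset_ball (x := (0 : ℂ × ℂ)) hδ1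
  rw [hfib w hw w' hw', Psi_fib D f0 hN hper w (hb hw) w' (hb hw')]
  constructor
  · rintro ⟨q, h, hh, hq, h1, h2⟩
    obtain ⟨k, rfl⟩ := hG.2.2 q h hh hq
    rw [(hG.zpow k).2] at hq
    have hk := Rmul_inj hq
    obtain ⟨x, hx⟩ := cc_surj w.1
    have h3 := h2 x hx
    rw [ang_zpow, ha] at h1
    obtain ⟨n, j, rfl⟩ : ∃ (n : ℕ) (j : ℤ), k = 3 * j + n := ⟨(k % 3).toNat, k / 3, by omega⟩
    refine ⟨n, ?_⟩
    rw [zpow_add, zpow_mul, hs3, one_zpow, one_mul, zpow_natCast] at hk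
    rw [zpow_add₀ hom, zpow_mul, ho3, one_zpow, one_mul, zpow_natCast] at h1
    subst hk
    exact Prod.ext (by rw [← h3, cc_sgm_pow, hx]; rfl) h1
  · rintro ⟨k, rfl⟩
    refine ⟨(k : ℤ) * M, sgm ^ k, (hG.pow k).1, (hG.pow k).2, ?_, fun x hx => ?_⟩
    · rw [ang_zpow, ha, zpow_natCast]; rfl
    · rw [cc_sgm_pow, hx]; rfl

theorem per_conj (D : GlueingDatum 4) {f0 : Flg D} {N : ℕ}
    (hper : ∀ q : ℤ, (rtn D ^ q) f0 = f0 ↔ (N : ℤ) ∣ q) {g : Equiv.Perm (Fin 5)} (hg : fix34 g) :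
    ∀ q : ℤ, (rtn D ^ q) (Rmul g f0) = Rmul g f0 ↔ (N : ℤ) ∣ q := by
  intro q
  rw [← hper, rtn_zpow_Rmul D hg]
  constructor
  · intro h
    have := congrArg (Rmul g⁻¹) h
    rwa [Rmul_Rmul, Rmul_Rmul, mul_inv_cancel, Rmul_one, Rmul_one] at this
  · intro h
    rw [h]

theorem cycl_of_euclid (D : GlueingDatum 4) (hE : EuclidAll D) : Cycl D := by
  by_contra hC
  obtain ⟨f0, q, g, hg, hne, hq⟩ := follow D hC
  obtain ⟨M, h, hh1, hG⟩ := exists_gen D hg hne hq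
  obtain ⟨N, hN, hper⟩ := exists_period D f0
  rcases fix34_class hG.1 hh1 with ⟨g, hg, hgg⟩ | ⟨g, hg, hgg⟩
  · have h1 := hG.conj hg
    rw [hgg] at h1
    exact no_two D hE (Rmul g f0) hN (per_conj D hper hg) h1
  · have h1 := hG.conj hg
    rw [hgg] at h1
    have hp1 := per_conj D hper hg
    have hs3 : sgm ^ (3 : ℤ) = 1 := by
      rw [zpow_ofNat]; exact sgm_facts.2.2.2.2
    have a3 := (h1.dvd hN hp1 3).2 hs3
    rw [zpow_ofNat] at a3
    obtain ⟨j, hj, hja⟩ := omg_prim.eq_pow_of_pow_eq_one a3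
    have hcases : j = 0 ∨ j = 1 ∨ j = 2 := by omega
    rcases hcases with rfl | rfl | rfl
    · rw [pow_zero] at hja
      have h2 := (h1.dvd hN hp1 1).1 (by rw [zpow_one, ← hja])
      rw [zpow_one] at h2
      have h3 := sgm_facts.1
      rw [h2] at h3
      exact absurd h3 (by decide)
    · rw [pow_one] at hja
      exact no_three D hE _ hN hp1 h1 hja.symm
    · have hsw : fix34 (Equiv.swap 1 2) := by unfold fix34; decide
      have h2 := h1.neg.conj hsw
      rw [show (Equiv.swap (1 : Fin 5) 2)⁻¹ * sgm⁻¹ * Equiv.swap 1 2 = sgm by decide] at h2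
      refine no_three D hE _ hN (per_conj D hp1 hsw) h2 ?_
      have h3 := ang_zpow N M (-1)
      rw [neg_one_mul] at h3
      rw [h3, ← hja, zpow_neg_one]
      apply inv_eq_of_mul_eq_one_right
      rw [← pow_succ, omg_pow_three]

/-- Proposition: condition Cycl holds if and only if the image in `X` of the barycentre
of every triangle (2-face) of every 4-simplex has an open neighborhood homeomorphic to
`ℝ⁴`. -/
theorem cycl_iff_triangle_barycentres_euclidean (D : GlueingDatum 4) :
    Cycl D ↔
      ∀ (i : D.I) (s : Finset (Fin 5)) (hs : s.card = 3),
        ∃ U : Set (GlueSpace D), IsOpen U ∧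
          Quot.mk (glueRel D) ⟨i, triangleBarycentre s hs⟩ ∈ U ∧
          Nonempty (↥U ≃ₜ EuclideanSpace ℝ (Fin 4)) := by
  exact ⟨fun h => euclid_of_cycl D h, fun h => cycl_of_euclid D h⟩
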